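/- arXiv:1607.02390 — 2 statements merged into one kernel-verified Lean document; each statement's English description precedes it below -/
import Mathlib

section
/- (Even gaps) For every j ≥ 0 and every τ > 0 there exists C > 0 such that for every h in (0, (a_{j+1}+τ)^(−3/2)], setting c = h^(−2/3): if E₂ ≤ 0 satisfies −c_{2j} ≤ −c − E₂ < −ã_{j+1} and v(−E₂)u'(−c−E₂) = u(−E₂)v'(−c−E₂), and E₃ ≤ 0 satisfies −a_{j+1} < −c − E₃ ≤ −c̃_{2j} and v'(−E₃)u(−c−E₃) = u'(−E₃)v(−c−E₃), then |(E₃ − E₂) − (a_{j+1} − ã_{j+1}) + √3·α·(u(−a_{j+1}))²·exp(−4/(3h) + 2·a_{j+1}·h^(−1/3))| ≤ C·h^(1/3)·exp(−4/(3h) + 2·a_{j+1}·h^(−1/3)). (Odd gaps) For every j ≥ 0 and every τ > 0 there exists C > 0 such that for every h in (0, (ã_{j+2}+τ)^(−3/2)], setting c = h^(−2/3): if E₂ ≤ 0 satisfies −c_{2j+1} ≤ −c − E₂ < −a_{j+1} and u(−E₂)v(−c−E₂) = v(−E₂)u(−c−E₂), and E₃ ≤ 0 satisfies −ã_{j+2}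 < −c − E₃ ≤ −c̃_{2j+1} and u'(−c−E₃)v'(−E₃) = v'(−c−E₃)u'(−E₃), then |(E₃ − E₂) − (ã_{j+2} − a_{j+1}) + √3·α·(u'(−ã_{j+2}))²/ã_{j+2}·exp(−4/(3h) + 2·ã_{j+2}·h^(−1/3))| ≤ C·h^(1/3)·exp(−4/(3h) + 2·ã_{j+2}·h^(−1/3)). (E₃ − E₂ is the width γ_p of the p-th rescaled spectral gap, p = 2j or p = 2j+1.) -/
open Real Set

/-- The standard Airy function `Ai` expressed in the basis of the canonical
solutions `u`, `v` of the Airy equation. -/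
noncomputable def AiF (u v : ℝ → ℝ) (x : ℝ) : ℝ :=
  u x / ((3:ℝ) ^ ((2:ℝ)/3) * Real.Gamma (2/3))
    - v x / ((3:ℝ) ^ ((1:ℝ)/3) * Real.Gamma (1/3))

/-- Derivative of the standard Airy function in the same basis. -/
noncomputable def AiD (u' v' : ℝ → ℝ) (x : ℝ) : ℝ :=
  u' x / ((3:ℝ) ^ ((2:ℝ)/3) * Real.Gamma (2/3))
    - v' x / ((3:ℝ) ^ ((1:ℝ)/3) * Real.Gamma (1/3))

/-- `α = Γ(1/3)/(3^(1/3)·Γ(2/3)) = −Ai(0)/Ai'(0)`. -/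
noncomputable def airyAlpha : ℝ :=
  Real.Gamma (1/3) / ((3:ℝ) ^ ((1:ℝ)/3) * Real.Gamma (2/3))

/-- The weight `(s (1 - s)) ^ (-5/6)` of the integral representation of `u`. -/
noncomputable def airyWeight (s : ℝ) : ℝ := s ^ (-(5:ℝ)/6) * (1 - s) ^ (-(5:ℝ)/6)

/-- The weighted exponential moments `∫₀¹ (s (1 - s)) ^ (-5/6) (1 - 2 s) ^ k e ^ (z (1 - 2 s)) ds`. -/
noncomputable def airyMoment (k : ℕ) (z : ℝ) : ℝ :=
  ∫ s in (0:ℝ)..1, airyWeight s * ((1 - 2 * s) ^ k * exp (z * (1 - 2 * s)))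

lemma intervalIntegrable_beta {p q : ℝ} (hp : 0 < p) (hq : 0 < q) :
    IntervalIntegrable (fun s : ℝ => s ^ (p - 1) * (1 - s) ^ (q - 1)) MeasureTheory.volume 0 1 := by
  have h := (Complex.betaIntegral_convergent (u := (p : ℂ)) (v := (q : ℂ)) (by simpa) (by simpa)).norm
  rw [intervalIntegrable_iff_integrableOn_Ioo_of_le zero_le_one] at h ⊢
  refine h.congr_fun (fun s hs => ?_) measurableSet_Ioo
  have h1 : 0 < 1 - s := by linarith [hs.2]
  simp only [norm_mul]
  rw [Complex.norm_cpow_eq_rpow_re_of_pos hs.1, ← Complex.ofReal_one, ← Complex.ofReal_sub 1 s,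
    Complex.norm_cpow_eq_rpow_re_of_pos h1]
  simp

lemma integral_beta {p q : ℝ} (hp : 0 < p) (hq : 0 < q) :
    ∫ s in (0:ℝ)..1, s ^ (p - 1) * (1 - s) ^ (q - 1)
      = Gamma p * Gamma q / Gamma (p + q) := by
  have h := ProbabilityTheory.beta_eq_betaIntegralReal p q hp hq
  rw [ProbabilityTheory.beta] at h
  rw [h, ← Complex.ofReal_re (∫ s in (0:ℝ)..1, s ^ (p - 1) * (1 - s) ^ (q - 1)),
    ← intervalIntegral.integral_ofReal, Complex.betaIntegral]
  congr 1
  refine intervalIntegral.integral_congr fun s hs => ?_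
  rw [uIcc_of_le zero_le_one] at hs
  have h1 : 0 ≤ 1 - s := by linarith [hs.2]
  simp only [Complex.ofReal_mul]
  rw [Complex.ofReal_cpow hs.1, Complex.ofReal_cpow h1]
  simp

lemma intervalIntegrable_airyWeight :
    IntervalIntegrable airyWeight MeasureTheory.volume 0 1 := by
  have := intervalIntegrable_beta (p := 1/6) (q := 1/6) (by norm_num) (by norm_num)
  norm_num at this
  refine this.congr (fun s _ => ?_)
  simp [airyWeight, neg_div]

lemma integral_airyWeight :
    ∫ s in (0:ℝ)..1, airyWeight s = Gamma (1/6) ^ 2 / Gamma (1/3) := by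
  have := integral_beta (p := 1/6) (q := 1/6) (by norm_num) (by norm_num)
  norm_num at this
  rw [sq]
  norm_num [airyWeight]
  exact this

lemma airyWeight_nonneg {s : ℝ} (h0 : 0 ≤ s) (h1 : s ≤ 1) : 0 ≤ airyWeight s :=
  mul_nonneg (rpow_nonneg h0 _) (rpow_nonneg (by linarith) _)

lemma intervalIntegrable_airyWeight_mul {g : ℝ → ℝ} (hg : Continuous g) :
    IntervalIntegrable (fun s => airyWeight s * g s) MeasureTheory.volume 0 1 :=
  intervalIntegrable_airyWeight.mul_continuousOn hg.continuousOn

lemma hasDerivAt_airyMoment (k : ℕ) (z : ℝ) :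
    HasDerivAt (airyMoment k) (airyMoment (k + 1) z) z := by
  have hcont : ∀ (k : ℕ) (y : ℝ),
      Continuous fun s : ℝ => (1 - 2 * s) ^ k * exp (y * (1 - 2 * s)) := fun k y => by fun_prop
  refine (intervalIntegral.hasDerivAt_integral_of_dominated_loc_of_deriv_le
    (F := fun y s => airyWeight s * ((1 - 2 * s) ^ k * exp (y * (1 - 2 * s))))
    (F' := fun y s => airyWeight s * ((1 - 2 * s) ^ (k + 1) * exp (y * (1 - 2 * s))))
    (bound := fun s => airyWeight s * exp (|z| + 1))
    (Metric.ball_mem_nhds z one_pos) (Filter.Eventually.of_forall fun y => ?_)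
    (intervalIntegrable_airyWeight_mul (hcont k z)) ?_
    (Filter.Eventually.of_forall fun s hs y hy => ?_)
    (intervalIntegrable_airyWeight_mul continuous_const)
    (Filter.Eventually.of_forall fun s hs y hy => ?_)).2
  · exact (intervalIntegrable_airyWeight_mul (hcont k y)).def'.aestronglyMeasurable
  · exact (intervalIntegrable_airyWeight_mul (hcont (k + 1) z)).def'.aestronglyMeasurable
  · rw [uIoc_of_le zero_le_one] at hs
    have h0 := airyWeight_nonneg hs.1.le hs.2
    have ha : |1 - 2 * s| ≤ 1 := abs_le.2 ⟨by linarith [hs.2], by linarith [hs.1]⟩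
    have hy' : |y| ≤ |z| + 1 := by
      have := Metric.mem_ball.1 hy
      rw [Real.dist_eq] at this
      have := abs_sub_abs_le_abs_sub y z
      linarith
    rw [norm_mul, norm_mul, norm_pow, norm_of_nonneg h0, norm_of_nonneg (exp_pos _).le]
    refine mul_le_mul_of_nonneg_left ?_ h0
    have h1 : ‖1 - 2 * s‖ ^ (k + 1) ≤ 1 := pow_le_one₀ (norm_nonneg _) ha
    have h2 : y * (1 - 2 * s) ≤ |z| + 1 := by
      calc y * (1 - 2 * s) ≤ |y * (1 - 2 * s)| := le_abs_self _
        _ = |y| * |1 - 2 * s| := abs_mul _ _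
        _ ≤ |y| * 1 := by gcongr
        _ ≤ |z| + 1 := by linarith
    calc ‖1 - 2 * s‖ ^ (k + 1) * exp (y * (1 - 2 * s)) ≤ 1 * exp (|z| + 1) := by gcongr
      _ = _ := one_mul _
  · have h := ((hasDerivAt_id y).mul_const (1 - 2 * s)).exp.const_mul
      (airyWeight s * (1 - 2 * s) ^ k)
    refine (h.congr_deriv ?_).congr_of_eventuallyEq (Filter.Eventually.of_forall fun t => ?_)
    · simp; ring
    · simp; ring

lemma airyMoment_bessel (z : ℝ) :
    3 * z * (airyMoment 0 z - airyMoment 2 z) = airyMoment 1 z := by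
  have hI : ∀ k : ℕ, IntervalIntegrable
      (fun s => airyWeight s * ((1 - 2 * s) ^ k * exp (z * (1 - 2 * s))))
      MeasureTheory.volume 0 1 := fun k => intervalIntegrable_airyWeight_mul (by fun_prop)
  have key := intervalIntegral.integral_eq_sub_of_hasDerivAt_of_le (a := (0:ℝ)) (b := 1)
    (f := fun s => s ^ ((1:ℝ)/6) * (1 - s) ^ ((1:ℝ)/6) * exp (z * (1 - 2 * s)))
    (f' := fun s => 1 / 6 * (airyWeight s * ((1 - 2 * s) ^ 1 * exp (z * (1 - 2 * s))))
      - z / 2 * (airyWeight s * ((1 - 2 * s) ^ 0 * exp (z * (1 - 2 * s)))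
        - airyWeight s * ((1 - 2 * s) ^ 2 * exp (z * (1 - 2 * s))))) zero_le_one ?_ ?_ ?_
  · rw [intervalIntegral.integral_sub ((hI 1).const_mul _) (((hI 0).sub (hI 2)).const_mul _),
      intervalIntegral.integral_const_mul, intervalIntegral.integral_const_mul,
      intervalIntegral.integral_sub (hI 0) (hI 2)] at key
    change 1 / 6 * airyMoment 1 z - z / 2 * (airyMoment 0 z - airyMoment 2 z) = _ at key
    norm_num at key
    linarith
  · refine ContinuousOn.mul (ContinuousOn.mul ?_ ?_) (by fun_prop)
    · exact continuousOn_id.rpow_const fun s _ => Or.inr (by norm_num)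
    · exact ContinuousOn.rpow_const (by fun_prop) fun s _ => Or.inr (by norm_num)
  · intro s hs
    have h1 : 0 < 1 - s := by linarith [hs.2]
    have d1 := hasDerivAt_rpow_const (x := s) (p := (1:ℝ)/6) (Or.inl hs.1.ne')
    have d2 := ((hasDerivAt_id s).const_sub 1).rpow_const (p := (1:ℝ)/6) (Or.inl h1.ne')
    have d3 := ((((hasDerivAt_id s).const_mul 2).const_sub 1).const_mul z).exp
    refine ((d1.mul d2).mul d3).congr_deriv ?_
    have e1 : s ^ ((1:ℝ)/6) = s * s ^ (-(5:ℝ)/6) := by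
      rw [mul_comm, ← rpow_add_one hs.1.ne']; norm_num
    have e2 : (1 - s) ^ ((1:ℝ)/6) = (1 - s) * (1 - s) ^ (-(5:ℝ)/6) := by
      rw [mul_comm, ← rpow_add_one h1.ne']; norm_num
    have e3 : (1:ℝ)/6 - 1 = -(5:ℝ)/6 := by norm_num
    simp only [id, airyWeight, Pi.mul_apply, e1, e2, e3]
    ring
  · exact ((hI 1).const_mul _).sub (((hI 0).sub (hI 2)).const_mul _)

lemma airyMoment_zero_zero : airyMoment 0 0 = Gamma (1/6) ^ 2 / Gamma (1/3) := by
  rw [← integral_airyWeight]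
  simp [airyMoment]

lemma airyMoment_zero_pos (z : ℝ) : 0 < airyMoment 0 z := by
  refine intervalIntegral.intervalIntegral_pos_of_pos_on
    (intervalIntegrable_airyWeight_mul (by fun_prop)) (fun s hs => ?_) zero_lt_one
  have h1 : 0 < 1 - s := by linarith [hs.2]
  have := rpow_pos_of_pos hs.1 (-(5:ℝ)/6)
  have := rpow_pos_of_pos h1 (-(5:ℝ)/6)
  unfold airyWeight
  positivity

lemma airyMoment_zero_asymptotic : ∃ C : ℝ, 0 < C ∧ ∀ z : ℝ, 1 ≤ z →
    |exp (-z) * airyMoment 0 z - Gamma (1/6) * (2 * z) ^ (-(1:ℝ)/6)| ≤ C * z ^ (-(1:ℝ)/2) := by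
  set B : ℝ := ∫ s in (0:ℝ)..1, s ^ ((2:ℝ)/3 - 1) * (1 - s) ^ ((1:ℝ)/6 - 1) with hB
  have hBint := intervalIntegrable_beta (p := 2/3) (q := 1/6) (by norm_num) (by norm_num)
  have hB0 : 0 ≤ B := intervalIntegral.integral_nonneg zero_le_one fun s hs =>
    mul_nonneg (rpow_nonneg hs.1 _) (rpow_nonneg (by linarith [hs.2]) _)
  refine ⟨B + 1, by linarith, fun z hz => ?_⟩
  have hz0 : 0 < z := by linarith
  have hH : exp (-z) * airyMoment 0 z
      = ∫ s in (0:ℝ)..1, airyWeight s * exp (-(2 * z * s)) := by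
    rw [airyMoment, ← intervalIntegral.integral_const_mul]
    refine intervalIntegral.integral_congr fun s _ => ?_
    have : exp (-(2 * z * s)) = exp (-z) * exp (z * (1 - 2 * s)) := by
      rw [← exp_add]; congr 1; ring
    simp only [this, pow_zero]
    ring
  have hΓint : MeasureTheory.IntegrableOn
      (fun s : ℝ => s ^ ((1:ℝ)/6 - 1) * exp (-(2 * z * s))) (Ioi 0) := by
    have := integrableOn_rpow_mul_exp_neg_mul_rpow (s := (1:ℝ)/6 - 1) (p := 1) (b := 2 * z)
      (by norm_num) zero_lt_one (by positivity)
    simpa using this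
  have hΓ : ∫ s in Ioi (0:ℝ), s ^ ((1:ℝ)/6 - 1) * exp (-(2 * z * s))
      = Gamma (1/6) * (2 * z) ^ (-(1:ℝ)/6) := by
    rw [integral_rpow_mul_exp_neg_mul_Ioi (by norm_num) (by positivity), one_div (2 * z),
      inv_rpow (by positivity), ← rpow_neg (by positivity)]
    rw [mul_comm]
    norm_num
  have hsplit : ∫ s in Ioi (0:ℝ), s ^ ((1:ℝ)/6 - 1) * exp (-(2 * z * s))
      = (∫ s in (0:ℝ)..1, s ^ ((1:ℝ)/6 - 1) * exp (-(2 * z * s)))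
        + ∫ s in Ioi (1:ℝ), s ^ ((1:ℝ)/6 - 1) * exp (-(2 * z * s)) := by
    rw [intervalIntegral.integral_of_le zero_le_one, ← MeasureTheory.setIntegral_union
      (Ioc_disjoint_Ioi le_rfl) measurableSet_Ioi
      (hΓint.mono_set Ioc_subset_Ioi_self) (hΓint.mono_set (Ioi_subset_Ioi zero_le_one)),
      Ioc_union_Ioi_eq_Ioi zero_le_one]
  have hexp : MeasureTheory.IntegrableOn (fun s : ℝ => exp (-(2 * z) * s)) (Ioi 1) :=
    exp_neg_integrableOn_Ioi 1 (by positivity)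
  have htail0 : 0 ≤ ∫ s in Ioi (1:ℝ), s ^ ((1:ℝ)/6 - 1) * exp (-(2 * z * s)) :=
    MeasureTheory.setIntegral_nonneg measurableSet_Ioi fun s hs =>
      mul_nonneg (rpow_nonneg (by linarith [mem_Ioi.1 hs]) _) (exp_pos _).le
  have htail : ∫ s in Ioi (1:ℝ), s ^ ((1:ℝ)/6 - 1) * exp (-(2 * z * s)) ≤ z ^ (-(1:ℝ)/2) := by
    calc ∫ s in Ioi (1:ℝ), s ^ ((1:ℝ)/6 - 1) * exp (-(2 * z * s))
        ≤ ∫ s in Ioi (1:ℝ), exp (-(2 * z) * s) := by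
          refine MeasureTheory.setIntegral_mono_on
            (hΓint.mono_set (Ioi_subset_Ioi zero_le_one)) hexp measurableSet_Ioi fun s hs => ?_
          have h1 : s ^ ((1:ℝ)/6 - 1) ≤ 1 :=
            rpow_le_one_of_one_le_of_nonpos (le_of_lt hs) (by norm_num)
          rw [neg_mul]
          exact mul_le_of_le_one_left (exp_pos _).le h1
      _ = exp (-(2 * z)) / (2 * z) := by
          rw [integral_exp_mul_Ioi (by linarith)]
          field_simp
      _ ≤ 1 / z := by
          have : exp (-(2 * z)) ≤ 1 := exp_le_one_iff.2 (by linarith)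
          gcongr
          linarith
      _ = z ^ (-1:ℝ) := by rw [rpow_neg_one, one_div]
      _ ≤ z ^ (-(1:ℝ)/2) := rpow_le_rpow_of_exponent_le hz (by norm_num)
  have hI1 : IntervalIntegrable (fun s => airyWeight s * exp (-(2 * z * s)))
      MeasureTheory.volume 0 1 := intervalIntegrable_airyWeight_mul (by fun_prop)
  have hI2 : IntervalIntegrable (fun s : ℝ => s ^ ((1:ℝ)/6 - 1) * exp (-(2 * z * s)))
      MeasureTheory.volume 0 1 :=
    (intervalIntegrable_iff_integrableOn_Ioc_of_le zero_le_one).2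
      (hΓint.mono_set Ioc_subset_Ioi_self)
  have hpt : ∀ s ∈ Ioo (0:ℝ) 1,
      0 ≤ airyWeight s * exp (-(2 * z * s)) - s ^ ((1:ℝ)/6 - 1) * exp (-(2 * z * s)) ∧
      airyWeight s * exp (-(2 * z * s)) - s ^ ((1:ℝ)/6 - 1) * exp (-(2 * z * s))
        ≤ z ^ (-(1:ℝ)/2) * (s ^ ((2:ℝ)/3 - 1) * (1 - s) ^ ((1:ℝ)/6 - 1)) := by
    intro s hs
    have h1 : 0 < 1 - s := by linarith [hs.2]
    have hexp1 : (1:ℝ)/6 - 1 = -(5:ℝ)/6 := by norm_num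
    have hge : 1 ≤ (1 - s) ^ (-(5:ℝ)/6) :=
      one_le_rpow_of_pos_of_le_one_of_nonpos h1 (by linarith [hs.1]) (by norm_num)
    have hle : (1 - s) ^ (-(5:ℝ)/6) - 1 ≤ s * (1 - s) ^ (-(5:ℝ)/6) := by
      have e : (1 - s) * (1 - s) ^ (-(5:ℝ)/6) = (1 - s) ^ ((1:ℝ)/6) := by
        rw [mul_comm, ← rpow_add_one h1.ne']; norm_num
      have : (1 - s) ^ ((1:ℝ)/6) ≤ 1 := rpow_le_one h1.le (by linarith [hs.1]) (by norm_num)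
      nlinarith
    have hs56 : 0 < s ^ (-(5:ℝ)/6) := rpow_pos_of_pos hs.1 _
    have hex := exp_pos (-(2 * z * s))
    have hhalf : s ^ ((1:ℝ)/2) * exp (-(2 * z * s)) ≤ z ^ (-(1:ℝ)/2) := by
      have hzs : 0 < z * s := mul_pos hz0 hs.1
      have h2 : (z * s) ^ ((1:ℝ)/2) ≤ exp (2 * z * s) := by
        calc (z * s) ^ ((1:ℝ)/2) ≤ (exp (2 * (2 * z * s))) ^ ((1:ℝ)/2) := by
              refine rpow_le_rpow hzs.le ?_ (by norm_num)
              have := add_one_le_exp (2 * (2 * z * s))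
              nlinarith
          _ = exp (2 * z * s) := by rw [← exp_mul]; congr 1; ring
      rw [mul_rpow hz0.le hs.1.le] at h2
      have h3 : z ^ (-(1:ℝ)/2) * z ^ ((1:ℝ)/2) = 1 := by
        rw [← rpow_add hz0]; norm_num
      have h4 : 0 < z ^ (-(1:ℝ)/2) := rpow_pos_of_pos hz0 _
      have h5 : exp (2 * z * s) * exp (-(2 * z * s)) = 1 := by
        rw [← exp_add]; simp
      calc s ^ ((1:ℝ)/2) * exp (-(2 * z * s))
          = z ^ (-(1:ℝ)/2) * (z ^ ((1:ℝ)/2) * s ^ ((1:ℝ)/2)) * exp (-(2 * z * s)) := by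
            rw [← mul_assoc, h3, one_mul]
        _ ≤ z ^ (-(1:ℝ)/2) * exp (2 * z * s) * exp (-(2 * z * s)) := by gcongr
        _ = z ^ (-(1:ℝ)/2) := by rw [mul_assoc, h5, mul_one]
    have hsplit2 : s * s ^ (-(5:ℝ)/6) = s ^ ((2:ℝ)/3 - 1) * s ^ ((1:ℝ)/2) := by
      rw [← rpow_add hs.1, mul_comm, ← rpow_add_one hs.1.ne']; norm_num
    have hs3 : 0 < s ^ ((2:ℝ)/3 - 1) := rpow_pos_of_pos hs.1 _
    rw [hexp1, airyWeight]
    constructor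
    · have : 0 ≤ s ^ (-(5:ℝ)/6) * ((1 - s) ^ (-(5:ℝ)/6) - 1) * exp (-(2 * z * s)) := by
        have := sub_nonneg.2 hge
        positivity
      linarith
    · calc s ^ (-(5:ℝ)/6) * (1 - s) ^ (-(5:ℝ)/6) * exp (-(2 * z * s))
            - s ^ (-(5:ℝ)/6) * exp (-(2 * z * s))
          = s ^ (-(5:ℝ)/6) * ((1 - s) ^ (-(5:ℝ)/6) - 1) * exp (-(2 * z * s)) := by ring
        _ ≤ s ^ (-(5:ℝ)/6) * (s * (1 - s) ^ (-(5:ℝ)/6)) * exp (-(2 * z * s)) := by gcongr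
        _ = s * s ^ (-(5:ℝ)/6) * (1 - s) ^ (-(5:ℝ)/6) * exp (-(2 * z * s)) := by ring
        _ = s ^ ((2:ℝ)/3 - 1) * (1 - s) ^ (-(5:ℝ)/6)
              * (s ^ ((1:ℝ)/2) * exp (-(2 * z * s))) := by rw [hsplit2]; ring
        _ ≤ s ^ ((2:ℝ)/3 - 1) * (1 - s) ^ (-(5:ℝ)/6) * z ^ (-(1:ℝ)/2) := by
            gcongr
        _ = _ := by ring
  have hlo : 0 ≤ (∫ s in (0:ℝ)..1, airyWeight s * exp (-(2 * z * s)))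
      - ∫ s in (0:ℝ)..1, s ^ ((1:ℝ)/6 - 1) * exp (-(2 * z * s)) := by
    rw [sub_nonneg]
    refine intervalIntegral.integral_mono_on_of_le_Ioo zero_le_one hI2 hI1 fun s hs => ?_
    linarith [(hpt s hs).1]
  have hhi : (∫ s in (0:ℝ)..1, airyWeight s * exp (-(2 * z * s)))
      - ∫ s in (0:ℝ)..1, s ^ ((1:ℝ)/6 - 1) * exp (-(2 * z * s)) ≤ z ^ (-(1:ℝ)/2) * B := by
    rw [hB, ← intervalIntegral.integral_sub hI1 hI2, ← intervalIntegral.integral_const_mul]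
    exact intervalIntegral.integral_mono_on_of_le_Ioo zero_le_one (hI1.sub hI2)
      (hBint.const_mul _) fun s hs => (hpt s hs).2
  have hz12 : 0 < z ^ (-(1:ℝ)/2) := rpow_pos_of_pos hz0 _
  have hzB : 0 ≤ z ^ (-(1:ℝ)/2) * B := by positivity
  rw [hH, ← hΓ, hsplit, abs_le]
  constructor <;> nlinarith

lemma eq_of_forall_hasDerivAt_zero_Ici {W : ℝ → ℝ} (hc : ContinuousOn W (Ici 0))
    (hd : ∀ x, 0 < x → HasDerivAt W 0 x) {x : ℝ} (hx : 0 ≤ x) : W x = W 0 := by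
  rcases hx.eq_or_lt with rfl | hx
  · rfl
  obtain ⟨c, -, hc'⟩ := exists_hasDerivAt_eq_slope W (fun _ => 0) hx
    (hc.mono Icc_subset_Ici_self) fun t ht => hd t ht.1
  rw [eq_comm, div_eq_zero_iff] at hc'
  rcases hc' with h | h <;> linarith

lemma airy_eq_airyMoment {u u' : ℝ → ℝ} (hu : ∀ x, HasDerivAt u (u' x) x)
    (huAiry : ∀ x, HasDerivAt u' (x * u x) x) (hu0 : u 0 = 1) (hu'0 : u' 0 = 0)
    {x : ℝ} (hx : 0 ≤ x) : airyMoment 0 (2 / 3 * √x ^ 3) = airyMoment 0 0 * u x := by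
  have hz : ∀ x, 0 < x → HasDerivAt (fun x => 2 / 3 * √x ^ 3) (√x) x := fun x hx => by
    refine (((hasDerivAt_sqrt hx.ne').pow 3).const_mul (2 / 3)).congr_deriv ?_
    have := sqrt_pos.2 hx
    field_simp
    norm_num
  have hG : ∀ k x, 0 < x → HasDerivAt (fun x => airyMoment k (2 / 3 * √x ^ 3))
      (airyMoment (k + 1) (2 / 3 * √x ^ 3) * √x) x := fun k x hx =>
    HasDerivAt.comp (h₂ := airyMoment k) x (hasDerivAt_airyMoment k (2 / 3 * √x ^ 3)) (hz x hx)
  have hGc : ∀ k, Continuous fun x => airyMoment k (2 / 3 * √x ^ 3) := fun k =>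
    (continuous_iff_continuousAt.2 fun z => (hasDerivAt_airyMoment k z).continuousAt).comp
      (by fun_prop)
  have huc : Continuous u := continuous_iff_continuousAt.2 fun z => (hu z).continuousAt
  have huc' : Continuous u' := continuous_iff_continuousAt.2 fun z => (huAiry z).continuousAt
  have hpos := airyMoment_zero_pos
  have hW : ∀ x, 0 ≤ x →
      u x * (airyMoment 1 (2 / 3 * √x ^ 3) * √x) - u' x * airyMoment 0 (2 / 3 * √x ^ 3) = 0 := by
    intro x hx
    refine (eq_of_forall_hasDerivAt_zero_Ici
      (W := fun x => u x * (airyMoment 1 (2 / 3 * √x ^ 3) * √x)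
        - u' x * airyMoment 0 (2 / 3 * √x ^ 3)) ?_ (fun t ht => ?_) hx).trans ?_
    · have := hGc 0
      have := hGc 1
      fun_prop
    · refine (((hu t).mul ((hG 1 t ht).mul (hasDerivAt_sqrt ht.ne'))).sub
        ((huAiry t).mul (hG 0 t ht))).congr_deriv ?_
      have hb := airyMoment_bessel (2 / 3 * √t ^ 3)
      have hs := sqrt_pos.2 ht
      have hst : √t ^ 2 = t := sq_sqrt ht.le
      simp only [zero_add, Nat.reduceAdd, Pi.mul_apply]
      rw [← hb]
      have e : 1 / (2 * √t) * (3 * (2 / 3 * √t ^ 3)) = t := by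
        rw [← hst]; field_simp; rw [sqrt_sq hs.le]
      linear_combination (u t * (airyMoment 0 (2 / 3 * √t ^ 3) - airyMoment 2 (2 / 3 * √t ^ 3))) * e
        + u t * airyMoment 2 (2 / 3 * √t ^ 3) * hst
    · simp [hu'0]
  have hR := eq_of_forall_hasDerivAt_zero_Ici
    (W := fun x => u x / airyMoment 0 (2 / 3 * √x ^ 3)) ?_ (fun t ht => ?_) hx
  · have h0 := (hpos 0).ne'
    have h1 := (hpos (2 / 3 * √x ^ 3)).ne'
    simp only [hu0, sqrt_zero, ne_eq, OfNat.ofNat_ne_zero, not_false_eq_true, zero_pow,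
      mul_zero] at hR
    rw [div_eq_div_iff h1 h0] at hR
    linarith
  · exact (huc.div (hGc 0) fun x => (hpos _).ne').continuousOn
  · refine ((hu t).div (hG 0 t ht) (hpos _).ne').congr_deriv ?_
    have := hW t ht.le
    rw [div_eq_zero_iff]
    left
    simp only [zero_add]
    linarith

/-- The exponentially small scale `exp (-(4/3) y ^ (3/2))`. -/
noncomputable def airyDecay (y : ℝ) : ℝ := exp (-(4 / 3 * √y ^ 3))

lemma airyDecay_pos (y : ℝ) : 0 < airyDecay y := exp_pos _

lemma hasDerivAt_airyDecay {y : ℝ} (hy : 0 < y) :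
    HasDerivAt airyDecay (-(2 * √y * airyDecay y)) y := by
  refine ((((hasDerivAt_sqrt hy.ne').pow 3).const_mul (4 / 3)).neg.exp).congr_deriv ?_
  have := sqrt_pos.2 hy
  simp only [airyDecay, Pi.pow_apply, Pi.neg_apply]
  field_simp
  ring

lemma tendsto_airyDecay : Filter.Tendsto airyDecay Filter.atTop (nhds 0) := by
  refine tendsto_exp_neg_atTop_nhds_zero.comp (Filter.Tendsto.const_mul_atTop (by norm_num) ?_)
  exact (Filter.tendsto_pow_atTop (by norm_num)).comp tendsto_sqrt_atTop

/-- The connection constant between the two normalisations of the dominant solution. -/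
lemma two_sqrt_three_mul_airyAlpha :
    2 * √3 * airyAlpha
      = (4 / 3 : ℝ) ^ ((1:ℝ)/3) * (Gamma (1/6) / Gamma (1/3)) ^ 2 := by
  have hd := Gamma_mul_Gamma_add_half (1/6)
  have hr := Gamma_mul_Gamma_one_sub (1/3)
  norm_num at hd hr
  have g1 : 0 < Gamma (1/3) := Gamma_pos_of_pos (by norm_num)
  have g2 : 0 < Gamma (2/3) := Gamma_pos_of_pos (by norm_num)
  have g3 : 0 < Gamma (1/6) := Gamma_pos_of_pos (by norm_num)
  have h3 : √3 ^ 2 = (3:ℝ) := sq_sqrt (by norm_num)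
  have h43 : (4 / 3 : ℝ) ^ ((1:ℝ)/3) = (2:ℝ) ^ ((2:ℝ)/3) / (3:ℝ) ^ ((1:ℝ)/3) := by
    rw [div_rpow (by norm_num) (by norm_num)]
    rw [show (4:ℝ) = 2 ^ (2:ℝ) by norm_num, ← rpow_mul (by norm_num)]
    norm_num
  have h2 : (2:ℝ) ^ ((2:ℝ)/3) * ((2:ℝ) ^ ((2:ℝ)/3)) ^ 2 = 4 := by
    rw [← rpow_natCast, ← rpow_mul (by norm_num), ← rpow_add (by norm_num)]
    norm_num
  have hsπ : √π ^ 2 = π := sq_sqrt pi_pos.le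
  have hs3 : 0 < √3 := by positivity
  have c3 : 0 < (3:ℝ) ^ ((1:ℝ)/3) := by positivity
  have hr' : √3 * (Gamma (1/3) * Gamma (2/3)) = 2 * π := by
    rw [hr, mul_one_div, sin_pi_div_three]
    field_simp
  have hmain : 2 * √3 * Gamma (1/3) ^ 3
      = (2:ℝ) ^ ((2:ℝ)/3) * Gamma (1/6) ^ 2 * Gamma (2/3) := by
    refine mul_right_cancel₀ g2.ne' ?_
    calc 2 * √3 * Gamma (1/3) ^ 3 * Gamma (2/3)
        = 2 * Gamma (1/3) ^ 2 * (√3 * (Gamma (1/3) * Gamma (2/3))) := by ring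
      _ = 4 * Gamma (1/3) ^ 2 * √π ^ 2 := by rw [hr', hsπ]; ring
      _ = (2:ℝ) ^ ((2:ℝ)/3) * (Gamma (1/3) * (2:ℝ) ^ ((2:ℝ)/3) * √π) ^ 2 := by
          rw [← h2]; ring
      _ = (2:ℝ) ^ ((2:ℝ)/3) * Gamma (1/6) ^ 2 * Gamma (2/3) * Gamma (2/3) := by
          rw [← hd]; ring
  rw [h43, airyAlpha]
  field_simp
  linear_combination hmain

lemma airy_asymptotic {u u' : ℝ → ℝ} (hu : ∀ x, HasDerivAt u (u' x) x)
    (huAiry : ∀ x, HasDerivAt u' (x * u x) x) (hu0 : u 0 = 1) (hu'0 : u' 0 = 0) :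
    ∃ C N : ℝ, 0 < C ∧ 0 < N ∧ 1 / N ^ 2 = 2 * √3 * airyAlpha ∧ ∀ y, 4 ≤ y →
      |√(√y) * exp (-(2 / 3 * √y ^ 3)) * u y - N| ≤ C / √y := by
  obtain ⟨C, hC, h⟩ := airyMoment_zero_asymptotic
  have g1 : 0 < Gamma (1/3) := Gamma_pos_of_pos (by norm_num)
  have g3 : 0 < Gamma (1/6) := Gamma_pos_of_pos (by norm_num)
  have hM := airyMoment_zero_pos 0
  have hM0 := airyMoment_zero_zero
  have c1 : 0 < (4 / 3 : ℝ) ^ (-(1:ℝ)/6) := by positivity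
  have c2 : 0 < (2 / 3 : ℝ) ^ (-(1:ℝ)/2) := by positivity
  refine ⟨C * (2 / 3 : ℝ) ^ (-(1:ℝ)/2) / airyMoment 0 0,
    Gamma (1/6) * (4 / 3 : ℝ) ^ (-(1:ℝ)/6) / airyMoment 0 0, by positivity, by positivity,
    ?_, fun y hy => ?_⟩
  · have e : (4 / 3 : ℝ) ^ ((1:ℝ)/3) * ((4 / 3 : ℝ) ^ (-(1:ℝ)/6)) ^ 2 = 1 := by
      rw [← rpow_natCast, ← rpow_mul (by norm_num), ← rpow_add (by norm_num)]
      norm_num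
    rw [neg_div] at e
    rw [two_sqrt_three_mul_airyAlpha, hM0, neg_div]
    field_simp
    linear_combination -e
  · have hσ : 2 ≤ √y := le_sqrt_of_sq_le (by linarith)
    have hσ0 : 0 < √y := by linarith
    have hP : 0 < √(√y) := sqrt_pos.2 hσ0
    have hz : 1 ≤ 2 / 3 * √y ^ 3 := by nlinarith [pow_le_pow_left₀ zero_le_two hσ 3]
    have hb := h _ hz
    rw [airy_eq_airyMoment hu huAiry hu0 hu'0 (by linarith : 0 ≤ y)] at hb
    have e1 : (2 * (2 / 3 * √y ^ 3)) ^ (-(1:ℝ)/6) = (4 / 3 : ℝ) ^ (-(1:ℝ)/6) / √(√y) := by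
      rw [← mul_assoc, mul_rpow (by norm_num) (by positivity), ← rpow_natCast,
        ← rpow_mul hσ0.le, sqrt_eq_rpow (√y), div_eq_mul_inv _ ((√y) ^ ((1:ℝ)/2)),
        ← rpow_neg hσ0.le]
      norm_num
    have e2 : (2 / 3 * √y ^ 3) ^ (-(1:ℝ)/2) = (2 / 3 : ℝ) ^ (-(1:ℝ)/2) / (√(√y) * √y) := by
      rw [mul_rpow (by norm_num) (by positivity), ← rpow_natCast,
        ← rpow_mul hσ0.le, sqrt_eq_rpow (√y), ← rpow_add_one hσ0.ne', div_eq_mul_inv _ ((√y) ^ _),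
        ← rpow_neg hσ0.le]
      norm_num
    rw [e1, e2] at hb
    have e3 : √(√y) * exp (-(2 / 3 * √y ^ 3)) * u y
          - Gamma (1/6) * (4 / 3 : ℝ) ^ (-(1:ℝ)/6) / airyMoment 0 0
        = √(√y) / airyMoment 0 0 * (exp (-(2 / 3 * √y ^ 3)) * (airyMoment 0 0 * u y)
          - Gamma (1/6) * ((4 / 3 : ℝ) ^ (-(1:ℝ)/6) / √(√y))) := by
      field_simp
    rw [e3, abs_mul, abs_of_pos (by positivity)]
    calc √(√y) / airyMoment 0 0 * _
        ≤ √(√y) / airyMoment 0 0 * (C * ((2 / 3 : ℝ) ^ (-(1:ℝ)/2) / (√(√y) * √y))) := by gcongr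
      _ = _ := by field_simp

lemma inv_airy_sq_asymptotic {u u' : ℝ → ℝ} (hu : ∀ x, HasDerivAt u (u' x) x)
    (huAiry : ∀ x, HasDerivAt u' (x * u x) x) (hu0 : u 0 = 1) (hu'0 : u' 0 = 0) :
    ∃ C Y : ℝ, 0 < C ∧ 4 ≤ Y ∧ ∀ y, Y ≤ y →
      |1 / u y ^ 2 - 2 * √3 * airyAlpha * √y * airyDecay y| ≤ C * airyDecay y := by
  obtain ⟨C, N, hC, hN, hNα, h⟩ := airy_asymptotic hu huAiry hu0 hu'0
  refine ⟨6 * C / N ^ 3, max 4 ((2 * C / N) ^ 2), by positivity, le_max_left _ _,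
    fun y hy => ?_⟩
  have hy4 : 4 ≤ y := (le_max_left _ _).trans hy
  have hσ0 : 0 < √y := sqrt_pos.2 (by linarith)
  have hσ : 2 * C / N ≤ √y := le_sqrt_of_sq_le ((le_max_right _ _).trans hy)
  have hP : 0 < √(√y) := sqrt_pos.2 hσ0
  have hPP : √(√y) ^ 2 = √y := sq_sqrt hσ0.le
  have hu1 : 0 < u y := by
    have := airy_eq_airyMoment hu huAiry hu0 hu'0 (by linarith : 0 ≤ y)
    have h1 := airyMoment_zero_pos (2 / 3 * √y ^ 3)
    rw [this] at h1
    exact pos_of_mul_pos_right h1 (airyMoment_zero_pos 0).le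
  have hb := h y hy4
  set q := √(√y) * exp (-(2 / 3 * √y ^ 3)) * u y with hq
  have hE : airyDecay y = exp (-(2 / 3 * √y ^ 3)) ^ 2 := by
    rw [airyDecay, ← exp_nat_mul]; congr 1; push_cast; ring
  have hq0 : 0 < q := by positivity
  have hCσ : C / √y ≤ N / 2 := by
    rw [div_le_iff₀ hN] at hσ
    rw [div_le_div_iff₀ hσ0 two_pos]
    linarith
  have hqN : N / 2 ≤ q := by linarith [(abs_le.1 hb).1]
  have e : 1 / u y ^ 2 = √y * airyDecay y / q ^ 2 := by
    rw [hE, hq, mul_pow, mul_pow, hPP]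
    field_simp
  have e2 : 1 / u y ^ 2 - 2 * √3 * airyAlpha * √y * airyDecay y
      = √y * airyDecay y * ((N - q) * (1 / (q * N ^ 2) + 1 / (q ^ 2 * N))) := by
    rw [e, ← hNα]
    field_simp
    ring
  have hD := airyDecay_pos y
  rw [e2, abs_mul, abs_of_pos (by positivity), abs_mul, abs_sub_comm,
    abs_of_pos (a := 1 / (q * N ^ 2) + _) (by positivity)]
  calc √y * airyDecay y * (|q - N| * (1 / (q * N ^ 2) + 1 / (q ^ 2 * N)))
      ≤ √y * airyDecay y * (C / √y * (1 / (N / 2 * N ^ 2) + 1 / ((N / 2) ^ 2 * N))) := by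
        gcongr
    _ = _ := by field_simp; ring

lemma monotoneOn_Ici_of_hasDerivAt_nonneg {g g' : ℝ → ℝ} {b : ℝ}
    (hg : ∀ x, b ≤ x → HasDerivAt g (g' x) x) (hg' : ∀ x, b < x → 0 ≤ g' x) :
    MonotoneOn g (Ici b) := by
  refine monotoneOn_of_hasDerivWithinAt_nonneg (f' := g') (convex_Ici b)
    (fun x hx => (hg x hx).continuousAt.continuousWithinAt)
    (fun x hx => ?_) fun x hx => ?_
  · rw [interior_Ici] at hx ⊢
    exact (hg x (le_of_lt hx)).hasDerivWithinAt
  · rw [interior_Ici] at hx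
    exact hg' x hx

/-- A function vanishing at infinity whose derivative is `O(airyDecay)` is `O(airyDecay y / √y)`. -/
lemma abs_le_airyDecay_div_sqrt {g g' : ℝ → ℝ} {C Y : ℝ} (hC : 0 < C) (hY : 0 < Y)
    (hg : ∀ y, Y ≤ y → HasDerivAt g (g' y) y) (hg' : ∀ y, Y ≤ y → |g' y| ≤ C * airyDecay y)
    (hlim : Filter.Tendsto g Filter.atTop (nhds 0)) {y : ℝ} (hy : Y ≤ y) :
    |g y| ≤ C / 2 * (airyDecay y / √y) := by
  have key : ∀ g g' : ℝ → ℝ, (∀ y, Y ≤ y → HasDerivAt g (g' y) y) →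
      (∀ y, Y ≤ y → |g' y| ≤ C * airyDecay y) → Filter.Tendsto g Filter.atTop (nhds 0) →
      g y ≤ C / 2 * (airyDecay y / √y) := by
    intro g g' hg hg' hlim
    have hs : 0 < √y := sqrt_pos.2 (hY.trans_le hy)
    have hm := monotoneOn_Ici_of_hasDerivAt_nonneg
      (g := fun t => g t - C / (2 * √y) * airyDecay t)
      (g' := fun t => g' t - C / (2 * √y) * (-(2 * √t * airyDecay t))) (b := y)
      (fun t ht => (hg t (hy.trans ht)).sub
        ((hasDerivAt_airyDecay (hY.trans_le (hy.trans ht))).const_mul _)) fun t ht => by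
        have h1 := (abs_le.1 (hg' t (hy.trans ht.le))).1
        have h2 : √y ≤ √t := sqrt_le_sqrt ht.le
        have h3 := airyDecay_pos t
        have h4 : C * airyDecay t ≤ C / (2 * √y) * (2 * √t * airyDecay t) := by
          have : C / (2 * √y) * (2 * √t * airyDecay t) = C * airyDecay t * (√t / √y) := by
            field_simp
          rw [this]
          exact le_mul_of_one_le_right (by positivity) ((one_le_div hs).2 h2)
        linarith
    have hl : Filter.Tendsto (fun t => g t - C / (2 * √y) * airyDecay t) Filter.atTop (nhds 0) := by
      simpa using hlim.sub (tendsto_airyDecay.const_mul (C / (2 * √y)))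
    have h0 : g y - C / (2 * √y) * airyDecay y ≤ 0 :=
      ge_of_tendsto hl ((Filter.eventually_ge_atTop y).mono fun t ht =>
        hm self_mem_Ici ht ht)
    have : C / 2 * (airyDecay y / √y) = C / (2 * √y) * airyDecay y := by
      field_simp
    linarith
  refine abs_le.2 ⟨?_, key g g' hg hg' hlim⟩
  have := key (fun t => -g t) (fun t => -g' t) (fun t ht => (hg t ht).neg)
    (fun t ht => by simpa using hg' t ht) (by simpa using hlim.neg)
  linarith

/-- `u`, `v` are the canonical solutions of the Airy equation, with derivatives `u'`, `v'`. -/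
structure IsAiryBasis (u v u' v' : ℝ → ℝ) : Prop where
  hasDerivAt_u : ∀ x, HasDerivAt u (u' x) x
  hasDerivAt_u' : ∀ x, HasDerivAt u' (x * u x) x
  hasDerivAt_v : ∀ x, HasDerivAt v (v' x) x
  hasDerivAt_v' : ∀ x, HasDerivAt v' (x * v x) x
  u_zero : u 0 = 1
  u'_zero : u' 0 = 0
  v_zero : v 0 = 0
  v'_zero : v' 0 = 1

lemma airyAlpha_pos : 0 < airyAlpha := by
  have g1 : 0 < Gamma (1/3) := Gamma_pos_of_pos (by norm_num)
  have g2 : 0 < Gamma (2/3) := Gamma_pos_of_pos (by norm_num)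
  unfold airyAlpha
  positivity

/-- The recessive combination `α u - v` of the canonical solutions. -/
noncomputable def airyRec (u v : ℝ → ℝ) (x : ℝ) : ℝ := airyAlpha * u x - v x

namespace IsAiryBasis

variable {u v u' v' : ℝ → ℝ}

lemma hasDerivAt_rec (H : IsAiryBasis u v u' v') (x : ℝ) :
    HasDerivAt (airyRec u v) (airyRec u' v' x) x :=
  ((H.hasDerivAt_u x).const_mul _).sub (H.hasDerivAt_v x)

lemma hasDerivAt_rec' (H : IsAiryBasis u v u' v') (x : ℝ) :
    HasDerivAt (airyRec u' v') (x * airyRec u v x) x :=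
  (((H.hasDerivAt_u' x).const_mul airyAlpha).sub (H.hasDerivAt_v' x)).congr_deriv
    (by simp only [airyRec]; ring)

lemma wronskian (H : IsAiryBasis u v u' v') (x : ℝ) : u x * v' x - u' x * v x = 1 := by
  have h : ∀ x, HasDerivAt (fun x => u x * v' x - u' x * v x) 0 x := fun x =>
    (((H.hasDerivAt_u x).mul (H.hasDerivAt_v' x)).sub
      ((H.hasDerivAt_u' x).mul (H.hasDerivAt_v x))).congr_deriv (by ring)
  have := is_const_of_deriv_eq_zero (fun x => (h x).differentiableAt) (fun x => (h x).deriv) x 0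
  simpa [H.u_zero, H.v'_zero, H.u'_zero] using this

lemma wronskian_rec (H : IsAiryBasis u v u' v') (x : ℝ) :
    airyRec u v x * u' x - airyRec u' v' x * u x = 1 := by
  have := H.wronskian x
  simp only [airyRec]
  linarith

lemma u_pos (H : IsAiryBasis u v u' v') {x : ℝ} (hx : 0 ≤ x) : 0 < u x := by
  have h1 := airyMoment_zero_pos (2 / 3 * √x ^ 3)
  rw [airy_eq_airyMoment H.hasDerivAt_u H.hasDerivAt_u' H.u_zero H.u'_zero hx] at h1
  exact pos_of_mul_pos_right h1 (airyMoment_zero_pos 0).le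

lemma u'_pos (H : IsAiryBasis u v u' v') {x : ℝ} (hx : 0 < x) : 0 < u' x := by
  have hm : StrictMonoOn u' (Ici 0) := by
    refine strictMonoOn_of_hasDerivWithinAt_pos (f' := fun x => x * u x) (convex_Ici 0)
      (fun x _ => (H.hasDerivAt_u' x).continuousAt.continuousWithinAt)
      (fun x _ => (H.hasDerivAt_u' x).hasDerivWithinAt) fun x hx => ?_
    rw [interior_Ici] at hx
    exact mul_pos hx (H.u_pos (le_of_lt hx))
  have := hm self_mem_Ici hx.le hx
  rwa [H.u'_zero] at this

lemma tendsto_u (H : IsAiryBasis u v u' v') : Filter.Tendsto u Filter.atTop Filter.atTop := by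
  have hm : MonotoneOn u' (Ici 1) := monotoneOn_Ici_of_hasDerivAt_nonneg
    (fun x _ => H.hasDerivAt_u' x)
    fun x hx => mul_nonneg (by linarith) (H.u_pos (by linarith)).le
  have hl := monotoneOn_Ici_of_hasDerivAt_nonneg (g := fun x => u x - u' 1 * x)
    (g' := fun x => u' x - u' 1) (b := 1)
    (fun x _ => (H.hasDerivAt_u x).sub (by simpa using (hasDerivAt_id x).const_mul (u' 1)))
    fun x hx => sub_nonneg.2 (hm self_mem_Ici hx.le hx.le)
  have h1 := H.u'_pos one_pos
  have h2 := H.u_pos zero_le_one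
  refine Filter.tendsto_atTop_mono' _ ((Filter.eventually_ge_atTop 1).mono fun x hx => ?_)
    (Filter.tendsto_atTop_add_const_right _ (-u' 1) (Filter.tendsto_id.const_mul_atTop h1))
  have h3 : u 1 - u' 1 * 1 ≤ u x - u' 1 * x := hl self_mem_Ici hx hx
  simp only [id]
  linarith

lemma rec_pos (H : IsAiryBasis u v u' v') (hf : ∀ x, 0 ≤ x → airyRec u v x ≠ 0) {x : ℝ}
    (hx : 0 ≤ x) : 0 < airyRec u v x := by
  have hc : ContinuousOn (airyRec u v) (Icc 0 x) :=
    fun t _ => (H.hasDerivAt_rec t).continuousAt.continuousWithinAt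
  by_contra! h
  obtain ⟨t, ht, ht0⟩ := intermediate_value_Icc' hx hc
    (show (0:ℝ) ∈ _ from ⟨h, by simp [airyRec, H.u_zero, H.v_zero, airyAlpha_pos.le]⟩)
  exact hf t ht.1 ht0

lemma rec'_neg (H : IsAiryBasis u v u' v') (hf' : ∀ x, 0 ≤ x → airyRec u' v' x ≠ 0) {x : ℝ}
    (hx : 0 ≤ x) : airyRec u' v' x < 0 := by
  have hc : ContinuousOn (airyRec u' v') (Icc 0 x) :=
    fun t _ => (H.hasDerivAt_rec' t).continuousAt.continuousWithinAt
  by_contra! h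
  obtain ⟨t, ht, ht0⟩ := intermediate_value_Icc hx hc
    (show (0:ℝ) ∈ _ from ⟨by simp [airyRec, H.u'_zero, H.v'_zero], h⟩)
  exact hf' t ht.1 ht0

lemma tendsto_rec_div (H : IsAiryBasis u v u' v') (hf : ∀ x, 0 ≤ x → airyRec u v x ≠ 0)
    (hf' : ∀ x, 0 ≤ x → airyRec u' v' x ≠ 0) :
    Filter.Tendsto (fun y => airyRec u v y / u y) Filter.atTop (nhds 0) := by
  have hm := monotoneOn_Ici_of_hasDerivAt_nonneg (b := 0)
    (fun x _ => (H.hasDerivAt_rec x).neg) fun x hx => by linarith [H.rec'_neg hf' (le_of_lt hx)]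
  refine squeeze_zero' ((Filter.eventually_ge_atTop 0).mono fun y hy =>
      (div_pos (H.rec_pos hf hy) (H.u_pos hy)).le)
    ((Filter.eventually_ge_atTop 0).mono fun y hy => ?_)
    (H.tendsto_u.const_div_atTop (airyRec u v 0))
  have h1 := hm self_mem_Ici hy hy
  simp only [Pi.neg_apply, neg_le_neg_iff] at h1
  have := H.u_pos hy
  gcongr

/-- Asymptotics of `α - v / u` at `+∞`. -/
lemma rec_div_asymptotic (H : IsAiryBasis u v u' v') (hf : ∀ x, 0 ≤ x → airyRec u v x ≠ 0)
    (hf' : ∀ x, 0 ≤ x → airyRec u' v' x ≠ 0) :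
    ∃ C Y : ℝ, 0 < C ∧ 4 ≤ Y ∧ ∀ y, Y ≤ y →
      |airyRec u v y / u y - √3 * airyAlpha * airyDecay y| ≤ C * (airyDecay y / √y) := by
  obtain ⟨C, Y, hC, hY, h⟩ := inv_airy_sq_asymptotic H.hasDerivAt_u H.hasDerivAt_u' H.u_zero
    H.u'_zero
  refine ⟨C / 2, Y, by positivity, hY, fun y hy => ?_⟩
  refine abs_le_airyDecay_div_sqrt
    (g := fun y => airyRec u v y / u y - √3 * airyAlpha * airyDecay y)
    (g' := fun y => -(1 / u y ^ 2 - 2 * √3 * airyAlpha * √y * airyDecay y)) (Y := Y)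
    hC (by linarith) (fun t ht => ?_) (fun t ht => ?_) ?_ hy
  · have ht0 : 0 < t := by linarith
    have hut := H.u_pos ht0.le
    refine (((H.hasDerivAt_rec t).div (H.hasDerivAt_u t) hut.ne').sub
      ((hasDerivAt_airyDecay ht0).const_mul _)).congr_deriv ?_
    have hw : airyRec u' v' t * u t - airyRec u v t * u' t = -1 := by
      linarith [H.wronskian_rec t]
    rw [hw]
    ring
  · rw [abs_neg]
    exact h t ht
  · simpa using (H.tendsto_rec_div hf hf').sub (tendsto_airyDecay.const_mul (√3 * airyAlpha))

/-- The logarithmic derivative of `u` is `√y (1 + O(1 / √y))`. -/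
lemma sqrt_mul_u_div_u' (H : IsAiryBasis u v u' v') :
    ∃ C Y : ℝ, 0 < C ∧ 4 ≤ Y ∧ ∀ y, Y ≤ y → |√y * u y / u' y - 1| ≤ C / √y := by
  have hu1 := H.u_pos zero_le_one
  have hu'1 := H.u'_pos one_pos
  set m := min 1 (u' 1 / u 1) with hm
  have hm0 : 0 < m := by positivity
  have hm1 : m ≤ 1 := min_le_left _ _
  have hmu : m * u 1 ≤ u' 1 := by
    rw [← le_div_iff₀ hu1]; exact min_le_right _ _
  have hlow : ∀ y, 1 ≤ y → m * u y ≤ u' y := by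
    intro y hy
    have hmono := monotoneOn_Ici_of_hasDerivAt_nonneg (g := fun y => u' y ^ 2 - m ^ 2 * u y ^ 2)
      (b := 1)
      (fun x _ => ((H.hasDerivAt_u' x).pow 2).sub (((H.hasDerivAt_u x).pow 2).const_mul (m ^ 2)))
      fun x hx => by
        have h1 := H.u_pos (by linarith : 0 ≤ x)
        have h2 := H.u'_pos (by linarith : 0 < x)
        have h3 : m ^ 2 ≤ x := (pow_le_one₀ hm0.le hm1).trans hx.le
        have h4 : 0 ≤ 2 * (u x * u' x) * (x - m ^ 2) :=
          mul_nonneg (by positivity) (sub_nonneg.2 h3)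
        norm_num
        linarith
    have h5 : u' 1 ^ 2 - m ^ 2 * u 1 ^ 2 ≤ u' y ^ 2 - m ^ 2 * u y ^ 2 :=
      hmono self_mem_Ici hy hy
    have h6 : (m * u 1) ^ 2 ≤ u' 1 ^ 2 := pow_le_pow_left₀ (by positivity) hmu 2
    exact le_of_sq_le_sq (by nlinarith) (H.u'_pos (by linarith)).le
  have hup : ∀ y, 0 ≤ y → u' y ^ 2 ≤ y * u y ^ 2 := by
    intro y hy
    have hmono := monotoneOn_Ici_of_hasDerivAt_nonneg (g := fun y => y * u y ^ 2 - u' y ^ 2)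
      (g' := fun y => u y ^ 2) (b := 0)
      (fun x _ => (((hasDerivAt_id x).mul ((H.hasDerivAt_u x).pow 2)).sub
        ((H.hasDerivAt_u' x).pow 2)).congr_deriv (by simp; ring)) fun x _ => sq_nonneg _
    have h5 : 0 * u 0 ^ 2 - u' 0 ^ 2 ≤ y * u y ^ 2 - u' y ^ 2 := hmono self_mem_Ici hy hy
    rw [H.u'_zero] at h5
    linarith
  set K := 1 / m with hK
  have hK1 : 1 ≤ K := one_le_one_div hm0 hm1
  have hdef : ∀ y, 1 ≤ y → y * u y ^ 2 - u' y ^ 2 ≤ K * u y ^ 2 := by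
    intro y hy
    have hmono := monotoneOn_Ici_of_hasDerivAt_nonneg
      (g := fun y => K * u y ^ 2 - (y * u y ^ 2 - u' y ^ 2))
      (g' := fun y => u y * (2 * K * u' y - u y)) (b := 1)
      (fun x _ => (((((H.hasDerivAt_u x).pow 2).const_mul K)).sub
        (((hasDerivAt_id x).mul ((H.hasDerivAt_u x).pow 2)).sub
        ((H.hasDerivAt_u' x).pow 2))).congr_deriv (by simp; ring)) fun x hx => by
        have h1 := H.u_pos (by linarith : 0 ≤ x)
        have h2 := hlow x hx.le
        have h3 : u x ≤ K * u' x := by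
          rw [hK, one_div, ← div_eq_inv_mul, le_div_iff₀ hm0]
          linarith
        exact mul_nonneg h1.le (by linarith)
    have h5 : K * u 1 ^ 2 - (1 * u 1 ^ 2 - u' 1 ^ 2) ≤ K * u y ^ 2 - (y * u y ^ 2 - u' y ^ 2) :=
      hmono self_mem_Ici hy hy
    nlinarith [sq_nonneg (u 1), sq_nonneg (u' 1)]
  refine ⟨2 * K, max 4 (2 * K), by positivity, le_max_left _ _, fun y hy => ?_⟩
  have hy4 : 4 ≤ y := (le_max_left _ _).trans hy
  have hyK : 2 * K ≤ y := (le_max_right _ _).trans hy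
  have h1 := H.u_pos (by linarith : 0 ≤ y)
  have h2 := H.u'_pos (by linarith : 0 < y)
  have hs : 0 < √y := sqrt_pos.2 (by linarith)
  have hss : √y ^ 2 = y := sq_sqrt (by linarith)
  have hs1 : 1 ≤ √y := le_sqrt_of_sq_le (by linarith)
  have h3 := hup y (by linarith)
  have h4 := hdef y (by linarith)
  have h5 : u' y ≤ √y * u y :=
    le_of_sq_le_sq (by rw [mul_pow, hss]; exact h3) (by positivity)
  have e : √y * u y / u' y - 1 = (y * u y ^ 2 - u' y ^ 2) / (u' y * (√y * u y + u' y)) := by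
    rw [div_sub_one h2.ne', div_eq_div_iff h2.ne' (by positivity)]
    linear_combination u' y * u y ^ 2 * hss
  rw [e, abs_of_nonneg (div_nonneg (by linarith) (by positivity)), div_le_div_iff₀ (by positivity) hs]
  have h6 : y * u y ^ 2 ≤ 2 * u' y ^ 2 := by nlinarith [sq_nonneg (u y)]
  have h7 : u' y ^ 2 ≤ u' y * (√y * u y + u' y) := by nlinarith [mul_pos hs h1]
  calc (y * u y ^ 2 - u' y ^ 2) * √y ≤ K * u y ^ 2 * √y := by gcongr
    _ ≤ K * u y ^ 2 * y := by
      have : √y ≤ y := by nlinarith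
      gcongr
    _ = K * (y * u y ^ 2) := by ring
    _ ≤ K * (2 * u' y ^ 2) := by gcongr
    _ ≤ K * (2 * (u' y * (√y * u y + u' y))) := by gcongr
    _ = _ := by ring

/-- Asymptotics of `α - v' / u'` at `+∞`. -/
lemma rec'_div_asymptotic (H : IsAiryBasis u v u' v') (hf : ∀ x, 0 ≤ x → airyRec u v x ≠ 0)
    (hf' : ∀ x, 0 ≤ x → airyRec u' v' x ≠ 0) :
    ∃ C Y : ℝ, 0 < C ∧ 4 ≤ Y ∧ ∀ y, Y ≤ y →
      |airyRec u' v' y / u' y + √3 * airyAlpha * airyDecay y| ≤ C * (airyDecay y / √y) := by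
  obtain ⟨C₁, Y₁, hC₁, hY₁, h₁⟩ := H.rec_div_asymptotic hf hf'
  obtain ⟨C₂, Y₂, hC₂, hY₂, h₂⟩ := H.sqrt_mul_u_div_u'
  obtain ⟨C₃, Y₃, hC₃, hY₃, h₃⟩ := inv_airy_sq_asymptotic H.hasDerivAt_u H.hasDerivAt_u' H.u_zero
    H.u'_zero
  have hα := airyAlpha_pos
  refine ⟨C₁ + (C₃ * (1 + C₂) + 2 * √3 * airyAlpha * C₂), max Y₁ (max Y₂ Y₃), by positivity,
    hY₁.trans (le_max_left _ _), fun y hy => ?_⟩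
  have hy1 : Y₁ ≤ y := (le_max_left _ _).trans hy
  have hy2 : Y₂ ≤ y := ((le_max_left _ _).trans (le_max_right _ _)).trans hy
  have hy3 : Y₃ ≤ y := ((le_max_right _ _).trans (le_max_right _ _)).trans hy
  have hu0 := H.u_pos (by linarith : 0 ≤ y)
  have hu'0 := H.u'_pos (by linarith : 0 < y)
  have hs : 0 < √y := sqrt_pos.2 (by linarith)
  have hs1 : 1 ≤ √y := le_sqrt_of_sq_le (by linarith)
  have hD := airyDecay_pos y
  have b1 := h₁ y hy1
  have b2 := h₂ y hy2
  have b3 := h₃ y hy3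
  set q := √y * u y / u' y with hq
  have hw := H.wronskian_rec y
  have e : airyRec u' v' y / u' y + √3 * airyAlpha * airyDecay y
      = (airyRec u v y / u y - √3 * airyAlpha * airyDecay y)
        - ((1 / u y ^ 2 - 2 * √3 * airyAlpha * √y * airyDecay y) * (q / √y)
          + 2 * √3 * airyAlpha * airyDecay y * (q - 1)) := by
    have e1 : airyRec u' v' y / u' y = airyRec u v y / u y - 1 / u y ^ 2 * (q / √y) := by
      rw [hq]
      field_simp
      linarith
    rw [e1]
    field_simp
    ring
  have hq1 : |q| ≤ 1 + C₂ := by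
    have : C₂ / √y ≤ C₂ := div_le_self hC₂.le hs1
    have := abs_le.1 b2
    rw [abs_le]
    constructor <;> linarith
  have t1 : |(1 / u y ^ 2 - 2 * √3 * airyAlpha * √y * airyDecay y) * (q / √y)|
      ≤ C₃ * (1 + C₂) * (airyDecay y / √y) := by
    rw [abs_mul, abs_div, abs_of_pos hs]
    calc _ ≤ C₃ * airyDecay y * ((1 + C₂) / √y) := by gcongr
      _ = _ := by ring
  have t2 : |2 * √3 * airyAlpha * airyDecay y * (q - 1)|
      ≤ 2 * √3 * airyAlpha * C₂ * (airyDecay y / √y) := by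
    rw [abs_mul, abs_of_pos (by positivity)]
    calc _ ≤ 2 * √3 * airyAlpha * airyDecay y * (C₂ / √y) := by gcongr
      _ = _ := by ring
  rw [e]
  refine (abs_sub _ _).trans ?_
  refine (add_le_add b1 ((abs_add_le _ _).trans (add_le_add t1 t2))).trans (le_of_eq ?_)
  ring

end IsAiryBasis

/-- The linearisation at `x` of `airyDecay (t ^ 2 + x)` for large `t`. -/
noncomputable def airyDecayLin (x t : ℝ) : ℝ := exp (-(4 / 3 * t ^ 3) - 2 * t * x)

lemma airyDecayLin_pos (x t : ℝ) : 0 < airyDecayLin x t := exp_pos _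

lemma exists_airyDecay_add_eq {t x : ℝ} (ht : 0 < t) (hx : 0 ≤ t ^ 2 + x) :
    ∃ θ, 0 ≤ θ ∧ θ ≤ 4 / 3 * x ^ 2 / t ∧
      airyDecay (t ^ 2 + x) = exp (-(4 / 3 * t ^ 3) - 2 * t * x - θ) := by
  set s := √(t ^ 2 + x) with hs
  have hs0 : 0 ≤ s := sqrt_nonneg _
  have hss : s ^ 2 = t ^ 2 + x := sq_sqrt hx
  have hx' : x = s ^ 2 - t ^ 2 := by linarith
  refine ⟨4 / 3 * ((s - t) ^ 2 * (s + t / 2)), by positivity, ?_, ?_⟩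
  · rw [le_div_iff₀ ht, hx']
    have : 0 ≤ (s - t) ^ 2 * (s ^ 2 + s * t + t ^ 2 / 2) := by positivity
    nlinarith
  · unfold airyDecay
    rw [← hs, hx']
    ring_nf

lemma airyDecay_add_le {t x : ℝ} (ht : 0 < t) (hx : 0 ≤ t ^ 2 + x) :
    airyDecay (t ^ 2 + x) ≤ airyDecayLin x t := by
  obtain ⟨θ, h0, -, h⟩ := exists_airyDecay_add_eq ht hx
  rw [h, airyDecayLin]
  exact exp_le_exp.2 (by linarith)

lemma sq_mul_airyDecayLin_le {t x : ℝ} (ht : 1 + 2 * |x| ≤ t) :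
    t ^ 2 * airyDecayLin x t ≤ 2 := by
  have hx := neg_abs_le x
  have hx0 := abs_nonneg x
  have ht1 : 1 ≤ t := by linarith
  have h1 : airyDecayLin x t ≤ exp (-t) := by
    unfold airyDecayLin
    gcongr
    have : 0 ≤ t * (4 / 3 * t ^ 2 + 2 * x - 1) := mul_nonneg (by linarith) (by nlinarith)
    nlinarith
  have h2 := quadratic_le_exp_of_nonneg (by linarith : 0 ≤ t)
  calc t ^ 2 * airyDecayLin x t ≤ 2 * exp t * exp (-t) := by
        refine mul_le_mul ?_ h1 (airyDecayLin_pos x t).le (by positivity)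
        linarith
    _ = 2 := by rw [mul_assoc, ← exp_add]; simp

/-- A function with a single, simple zero on a compact interval controls the distance to it. -/
lemma exists_abs_sub_le_mul_abs {F F' : ℝ → ℝ} {p q x₀ : ℝ} (hF : ∀ x, HasDerivAt F (F' x) x)
    (h0 : F x₀ = 0) (h1 : F' x₀ ≠ 0) (hx₀ : x₀ ∈ Icc p q)
    (huniq : ∀ x ∈ Icc p q, F x = 0 → x = x₀) :
    ∃ m, 0 < m ∧ ∀ x ∈ Icc p q, |x - x₀| ≤ m * |F x| := by
  have hc : ContinuousOn (dslope F x₀) univ := by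
    rw [continuousOn_dslope Filter.univ_mem]
    exact ⟨fun x _ => (hF x).continuousAt.continuousWithinAt, (hF x₀).differentiableAt⟩
  obtain ⟨z, hz, hmin⟩ := isCompact_Icc.exists_isMinOn ⟨x₀, hx₀⟩
    ((hc.mono (subset_univ (Icc p q))).abs)
  have hsl : ∀ x, F x = (x - x₀) * dslope F x₀ x := fun x => by
    have := sub_smul_dslope F x₀ x
    rw [h0, sub_zero, smul_eq_mul] at this
    exact this.symm
  have hz0 : 0 < |dslope F x₀ z| := by
    rw [abs_pos]
    intro h
    have hzx := huniq z hz (by rw [hsl, h, mul_zero])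
    rw [hzx, dslope_same, (hF x₀).deriv] at h
    exact h1 h
  refine ⟨1 / |dslope F x₀ z|, by positivity, fun x hx => ?_⟩
  have h2 : |dslope F x₀ z| ≤ |dslope F x₀ x| := hmin hx
  rw [hsl x, abs_mul, one_div, ← div_eq_inv_mul, le_div_iff₀ hz0]
  gcongr

lemma exists_abs_le_on_Icc {U : ℝ → ℝ} (hU : Continuous U) (p q : ℝ) :
    ∃ M, 0 < M ∧ ∀ x ∈ Icc p q, |U x| ≤ M := by
  obtain ⟨M, hM⟩ := isCompact_Icc.exists_bound_of_continuousOn (hU.continuousOn (s := Icc p q))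
  exact ⟨max M 1, by positivity, fun x hx => (hM x hx).trans (le_max_left _ _)⟩

lemma exists_abs_sub_le_on_Icc {U U' : ℝ → ℝ} (hU : ∀ x, HasDerivAt U (U' x) x)
    (hU' : Continuous U') (p q : ℝ) :
    ∃ L, 0 < L ∧ ∀ x ∈ Icc p q, |U x - U p| ≤ L * (x - p) := by
  obtain ⟨L, hL, h⟩ := exists_abs_le_on_Icc hU' p q
  refine ⟨L, hL, fun x hx => ?_⟩
  have := (convex_Icc p q).norm_image_sub_le_of_norm_hasDerivWithin_le
    (fun z _ => (hU z).hasDerivWithinAt) h (left_mem_Icc.2 (hx.1.trans hx.2)) hx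
  rwa [Real.norm_eq_abs, Real.norm_eq_abs, abs_of_nonneg (sub_nonneg.2 hx.1)] at this

lemma exists_abs_taylor_le_on_Icc {F F' F'' : ℝ → ℝ} (hF : ∀ x, HasDerivAt F (F' x) x)
    (hF' : ∀ x, HasDerivAt F' (F'' x) x) (hF'' : Continuous F'') (p q : ℝ) :
    ∃ L, 0 < L ∧ ∀ x ∈ Icc p q, |F x - F p - F' p * (x - p)| ≤ L * (x - p) ^ 2 := by
  obtain ⟨L, hL, h⟩ := exists_abs_sub_le_on_Icc hF' hF'' p q
  refine ⟨L, hL, fun x hx => ?_⟩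
  have := (convex_Icc p x).norm_image_sub_le_of_norm_hasDerivWithin_le
    (f := fun z => F z - F' p * z) (f' := fun z => F' z - F' p) (C := L * (x - p))
    (fun z _ => ((hF z).sub (by simpa using (hasDerivAt_id z).const_mul (F' p))).hasDerivWithinAt)
    (fun z hz => (h z ⟨hz.1, hz.2.trans hx.2⟩).trans (by gcongr; exact hz.2))
    (left_mem_Icc.2 hx.1) (right_mem_Icc.2 hx.1)
  rw [Real.norm_eq_abs, Real.norm_eq_abs, abs_of_nonneg (sub_nonneg.2 hx.1)] at this
  calc _ = |F x - F' p * x - (F p - F' p * p)| := by ring_nf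
    _ ≤ _ := this
    _ = _ := by ring

/-- An estimate for bounded quantities valid for large `t` extends to all `t > 0`. -/
lemma exists_airyDecayLin_bound {P : ℝ → ℝ → Prop} {w : ℝ → ℝ} {x₀ σ S C T : ℝ} (hC : 0 < C)
    (hS : ∀ t x, P t x → |w x| ≤ S)
    (h : ∀ t, T ≤ t → 0 < t → ∀ x, P t x →
      |w x - σ * airyDecayLin x₀ t| ≤ C * (airyDecayLin x₀ t / t)) :
    ∃ C, 0 < C ∧ ∀ t, 0 < t → ∀ x, P t x →
      |w x - σ * airyDecayLin x₀ t| ≤ C * (airyDecayLin x₀ t / t) := by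
  set R := exp (4 / 3 * |T| ^ 3 + 2 * |T| * |x₀|) with hR
  refine ⟨C + |S| * R * |T| + |σ| * |T|, by positivity, fun t ht x hx => ?_⟩
  have hE := airyDecayLin_pos x₀ t
  by_cases hT : T ≤ t
  · refine (h t hT ht x hx).trans ?_
    gcongr
    have : 0 ≤ |S| * R * |T| + |σ| * |T| := by positivity
    linarith
  · have htT : t ≤ |T| := (not_le.1 hT).le.trans (le_abs_self _)
    have h1 : 1 ≤ R * airyDecayLin x₀ t := by
      rw [hR, airyDecayLin, ← exp_add]
      refine one_le_exp ?_
      have e1 : t ^ 3 ≤ |T| ^ 3 := by gcongr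
      have e2 : t * x₀ ≤ |T| * |x₀| := by
        calc t * x₀ ≤ t * |x₀| := by gcongr; exact le_abs_self _
          _ ≤ _ := by gcongr
      linarith
    have h2 : 1 ≤ |T| / t := (one_le_div ht).2 htT
    calc |w x - σ * airyDecayLin x₀ t| ≤ |w x| + |σ * airyDecayLin x₀ t| := abs_sub _ _
      _ ≤ |S| * (R * airyDecayLin x₀ t) * (|T| / t) + |σ| * airyDecayLin x₀ t * (|T| / t) := by
        rw [abs_mul, abs_of_pos hE]
        refine add_le_add ?_ (le_mul_of_one_le_right (by positivity) h2)
        refine ((hS t x hx).trans (le_abs_self S)).trans ?_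
        refine (le_mul_of_one_le_right (abs_nonneg S) h1).trans ?_
        exact le_mul_of_one_le_right (by positivity) h2
      _ = (|S| * R * |T| + |σ| * |T|) * (airyDecayLin x₀ t / t) := by ring
      _ ≤ _ := by
        gcongr
        linarith

/-- Perturbed zeros near the right endpoint `q` of an interval are exponentially close to `q`, with
a better exponential rate than at any `x₀ < q`. -/
lemma exists_abs_sub_le_airyDecayLin {F F' U ρ : ℝ → ℝ} {p q x₀ B Y : ℝ}
    (hF : ∀ x, HasDerivAt F (F' x) x) (hU : Continuous U) (hq : x₀ < q)
    (h0 : F q = 0) (h1 : F' q ≠ 0) (huniq : ∀ x ∈ Icc p q, F x = 0 → x = q) (hB : 0 < B)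
    (hρ : ∀ y, Y ≤ y → |ρ y| ≤ B * airyDecay y) :
    ∃ C, 0 < C ∧ ∀ t, 0 < t → ∀ x, x ∈ Icc p q ∧
      (0 < t ^ 2 + x → F x = ρ (t ^ 2 + x) * U x) →
      |x - q| ≤ C * (airyDecayLin x₀ t / t) := by
  rcases lt_or_ge q p with hpq | hpq
  · exact ⟨1, one_pos, fun t _ x hx => absurd (hx.1.1.trans hx.1.2) hpq.not_ge⟩
  obtain ⟨m, hm, hmF⟩ := exists_abs_sub_le_mul_abs hF h0 h1 ⟨hpq, le_rfl⟩ huniq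
  obtain ⟨M, hM, hMU⟩ := exists_abs_le_on_Icc hU p q
  set K := m * (B * M) with hK
  have hK0 : 0 < K := by positivity
  set d := (q - x₀) / 2 with hd
  have hd0 : 0 < d := by rw [hd]; linarith
  suffices ∃ C, 0 < C ∧ ∀ t, 0 < t → ∀ x, x ∈ Icc p q ∧
      (0 < t ^ 2 + x → F x = ρ (t ^ 2 + x) * U x) →
      |(x - q) - 0 * airyDecayLin x₀ t| ≤ C * (airyDecayLin x₀ t / t) by simpa using this
  refine exists_airyDecayLin_bound (C := K / (2 * d)) (S := q - p) (w := fun x => x - q)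
    (T := 1 + 2 * |p| + |Y| + 2 * K / d) (by positivity) ?_ ?_
  · rintro t x ⟨hx, -⟩
    rw [abs_le]
    constructor <;> linarith [hx.1, hx.2]
  rintro t hT ht x ⟨hx, hFx⟩
  have hp := neg_abs_le p
  have hp0 := abs_nonneg p
  have hY := le_abs_self Y
  have hY0 := abs_nonneg Y
  have hKd : 0 < 2 * K / d := by positivity
  have ht1 : 1 ≤ t := by linarith
  have htt : t ≤ t ^ 2 := by nlinarith
  have hy0 : 0 < t ^ 2 + x := by linarith [hx.1]
  have hyY : Y ≤ t ^ 2 + x := by linarith [hx.1]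
  have key : |x - q| ≤ K * airyDecayLin x t := by
    calc |x - q| ≤ m * |F x| := hmF x hx
      _ = m * (|ρ (t ^ 2 + x)| * |U x|) := by rw [hFx hy0, abs_mul]
      _ ≤ m * (B * airyDecayLin x t * M) := by
        have e1 : |ρ (t ^ 2 + x)| ≤ B * airyDecayLin x t :=
          (hρ _ hyY).trans (mul_le_mul_of_nonneg_left (airyDecay_add_le ht hy0.le) hB.le)
        have e2 := hMU x hx
        have e3 := airyDecayLin_pos x t
        gcongr
      _ = K * airyDecayLin x t := by rw [hK]; ring
  have hfar : |x - q| ≤ d := by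
    have e1 : airyDecayLin x t ≤ airyDecayLin p t := by
      unfold airyDecayLin
      gcongr
      exact hx.1
    have e2 := sq_mul_airyDecayLin_le (x := p) (t := t) (by linarith)
    have e3 : t * airyDecayLin p t ≤ 2 :=
      (mul_le_mul_of_nonneg_right htt (airyDecayLin_pos p t).le).trans e2
    have e4 : 2 * K / d ≤ t := by linarith
    rw [div_le_iff₀ hd0] at e4
    have e5 : K * airyDecayLin p t * t ≤ d * t := by nlinarith
    calc _ ≤ K * airyDecayLin x t := key
      _ ≤ K * airyDecayLin p t := by gcongr
      _ ≤ d := le_of_mul_le_mul_right e5 ht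
  have hxd : d ≤ x - x₀ := by
    have := (abs_le.1 hfar).1
    rw [hd] at this ⊢
    linarith
  rw [zero_mul, sub_zero]
  calc |x - q| ≤ K * airyDecayLin x t := key
    _ ≤ K * (airyDecayLin x₀ t * (1 / (2 * d * t))) := by
      gcongr
      have : airyDecayLin x t = airyDecayLin x₀ t * exp (-(2 * t * (x - x₀))) := by
        rw [airyDecayLin, airyDecayLin, ← exp_add]
        ring_nf
      rw [this]
      have := airyDecayLin_pos x₀ t
      gcongr
      rw [exp_neg, ← one_div]
      refine one_div_le_one_div_of_le (by positivity) ?_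
      have e1 : 2 * d * t ≤ 2 * t * (x - x₀) := by nlinarith
      linarith [add_one_le_exp (2 * t * (x - x₀))]
    _ = _ := by field_simp

/-- Asymptotics of perturbed zeros near the left endpoint `x₀` of an interval. -/
lemma exists_abs_sub_sub_le_airyDecayLin {F F' F'' U U' ρ : ℝ → ℝ} {x₀ q r B Y : ℝ}
    (hF : ∀ x, HasDerivAt F (F' x) x) (hF' : ∀ x, HasDerivAt F' (F'' x) x)
    (hF'' : Continuous F'') (hU : ∀ x, HasDerivAt U (U' x) x) (hU' : Continuous U')
    (h0 : F x₀ = 0) (h1 : F' x₀ ≠ 0)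
    (huniq : ∀ x ∈ Icc x₀ q, F x = 0 → x = x₀) (hB : 0 < B) (hY4 : 4 ≤ Y)
    (hρ : ∀ y, Y ≤ y → |ρ y - r * airyDecay y| ≤ B * (airyDecay y / √y)) :
    ∃ C, 0 < C ∧ ∀ t, 0 < t → ∀ x, x ∈ Icc x₀ q ∧
      (0 < t ^ 2 + x → F x = ρ (t ^ 2 + x) * U x) →
      |(x - x₀) - r * U x₀ / F' x₀ * airyDecayLin x₀ t| ≤ C * (airyDecayLin x₀ t / t) := by
  rcases lt_or_ge q x₀ with hq | hq
  · exact ⟨1, one_pos, fun t _ x hx => absurd (hx.1.1.trans hx.1.2) hq.not_ge⟩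
  obtain ⟨m, hm, hmF⟩ := exists_abs_sub_le_mul_abs hF h0 h1 ⟨le_rfl, hq⟩ huniq
  obtain ⟨M, hM, hMU⟩ := exists_abs_le_on_Icc
    (continuous_iff_continuousAt.2 fun x => (hU x).continuousAt) x₀ q
  obtain ⟨L, hL, hLF⟩ := exists_abs_taylor_le_on_Icc hF hF' hF'' x₀ q
  obtain ⟨N, hN, hNU⟩ := exists_abs_sub_le_on_Icc hU hU' x₀ q
  set K := m * ((|r| + B) * M) with hK
  have hK0 : 0 < K := by positivity
  set X := |x₀| + |q| with hX
  have hX0 : 0 ≤ X := by positivity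
  set C₁ := L * K ^ 2 * 2 + (2 * B * M + |r| * (4 * K + 4 / 3 * X ^ 2) * M + |r| * N * K * 2)
    with hC₁
  refine exists_airyDecayLin_bound (C := C₁ / |F' x₀|) (S := q - x₀) (w := fun x => x - x₀)
    (T := 1 + 2 * |x₀| + Y) (by positivity) ?_ ?_
  · rintro t x ⟨hx, -⟩
    rw [abs_of_nonneg (sub_nonneg.2 hx.1)]
    linarith [hx.2]
  rintro t hT ht x ⟨hx, hFx⟩
  have hp := neg_abs_le x₀
  have hp0 := abs_nonneg x₀
  have ht1 : 1 ≤ t := by linarith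
  have htt : t ≤ t ^ 2 := by nlinarith
  have hyY : Y ≤ t ^ 2 + x := by linarith [hx.1]
  have hy0 : 0 < t ^ 2 + x := by linarith
  set E := airyDecayLin x₀ t with hE
  set D := airyDecay (t ^ 2 + x) with hD
  set δ := x - x₀ with hδ
  have hδ0 : 0 ≤ δ := sub_nonneg.2 hx.1
  have hE0 : 0 < E := airyDecayLin_pos _ _
  have hD0 : 0 < D := airyDecay_pos _
  have hDE : D ≤ E := by
    refine (airyDecay_add_le ht hy0.le).trans ?_
    rw [hE]
    unfold airyDecayLin
    gcongr
    exact hx.1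
  have hEt : t ^ 2 * E ≤ 2 := sq_mul_airyDecayLin_le (by linarith)
  have hE2 : E ≤ 2 / t := by
    rw [le_div_iff₀ ht]
    nlinarith
  have hsy : t / 2 ≤ √(t ^ 2 + x) := by
    refine le_sqrt_of_sq_le ?_
    nlinarith [hx.1]
  have hρ1 := hρ _ hyY
  have hρ2 : |ρ (t ^ 2 + x)| ≤ (|r| + B) * D := by
    have e1 : D / √(t ^ 2 + x) ≤ D :=
      div_le_self hD0.le (le_sqrt_of_sq_le (by linarith))
    have e2 : |ρ (t ^ 2 + x)| ≤ |ρ (t ^ 2 + x) - r * D| + |r * D| := by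
      simpa using abs_add_le (ρ (t ^ 2 + x) - r * D) (r * D)
    rw [abs_mul, abs_of_pos hD0] at e2
    have e3 : B * (D / √(t ^ 2 + x)) ≤ B * D := by gcongr
    linarith
  have hδE : δ ≤ K * E := by
    calc δ = |x - x₀| := (abs_of_nonneg hδ0).symm
      _ ≤ m * |F x| := hmF x hx
      _ = m * (|ρ (t ^ 2 + x)| * |U x|) := by rw [hFx hy0, abs_mul]
      _ ≤ m * ((|r| + B) * E * M) := by
        gcongr
        · exact hρ2.trans (by gcongr)
        · exact hMU x hx
      _ = K * E := by rw [hK]; ring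
  have hED : |D - E| ≤ (4 * K + 4 / 3 * X ^ 2) * (E / t) := by
    obtain ⟨θ, hθ0, hθ, hDθ⟩ := exists_airyDecay_add_eq ht hy0.le
    have e1 : D = E * exp (-(2 * t * δ + θ)) := by
      rw [hD, hDθ, hE, airyDecayLin, ← exp_add, hδ]
      ring_nf
    have e2 := add_one_le_exp (-(2 * t * δ + θ))
    rw [abs_sub_comm, abs_of_nonneg (sub_nonneg.2 hDE)]
    have e3 : E - D ≤ E * (2 * t * δ + θ) := by
      have := mul_le_mul_of_nonneg_left e2 hE0.le
      rw [e1]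
      linarith
    have hxX : |x| ≤ X := by
      rw [abs_le, hX]
      constructor
      · linarith [hx.1, abs_nonneg q]
      · linarith [hx.2, le_abs_self q]
    have e4 : x ^ 2 ≤ X ^ 2 := sq_le_sq' (by linarith [(abs_le.1 hxX).1]) (abs_le.1 hxX).2
    have e5 : 2 * t * δ ≤ 4 * K / t := by
      rw [le_div_iff₀ ht]
      linarith [mul_le_mul_of_nonneg_left hδE (sq_nonneg t),
        mul_le_mul_of_nonneg_left hEt hK0.le]
    calc E - D ≤ E * (2 * t * δ + θ) := e3
      _ ≤ E * (4 * K / t + 4 / 3 * X ^ 2 / t) := by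
        gcongr
        exact hθ.trans (by gcongr)
      _ = _ := by ring
  have hTaylor := hLF x hx
  rw [h0, sub_zero] at hTaylor
  have hUx := hMU x hx
  have b0 : |F x - F' x₀ * δ| ≤ L * K ^ 2 * 2 * (E / t) := by
    calc _ ≤ L * δ ^ 2 := hTaylor
      _ ≤ L * (K * E) ^ 2 := by gcongr
      _ = L * K ^ 2 * E * E := by ring
      _ ≤ L * K ^ 2 * E * (2 / t) := by gcongr
      _ = _ := by ring
  have b1 : |(ρ (t ^ 2 + x) - r * D) * U x| ≤ 2 * B * M * (E / t) := by
    rw [abs_mul]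
    calc _ ≤ B * (E / (t / 2)) * M := by
          gcongr
          exact hρ1.trans (by gcongr)
      _ = _ := by field_simp
  have b2 : |r * (D - E) * U x| ≤ |r| * (4 * K + 4 / 3 * X ^ 2) * M * (E / t) := by
    rw [abs_mul, abs_mul]
    calc _ ≤ |r| * ((4 * K + 4 / 3 * X ^ 2) * (E / t)) * M := by gcongr
      _ = _ := by ring
  have b3 : |r * E * (U x - U x₀)| ≤ |r| * N * K * 2 * (E / t) := by
    rw [abs_mul, abs_mul, abs_of_pos hE0]
    calc _ ≤ |r| * E * (N * (K * E)) := by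
          gcongr
          exact (hNU x hx).trans (by gcongr)
      _ = |r| * N * K * E * E := by ring
      _ ≤ |r| * N * K * E * (2 / t) := by gcongr
      _ = _ := by ring
  have hF'0 : 0 < |F' x₀| := abs_pos.2 h1
  have e : (x - x₀) - r * U x₀ / F' x₀ * E = (F' x₀ * δ - r * U x₀ * E) / F' x₀ := by
    rw [hδ]
    field_simp
  have htot : |F' x₀ * δ - r * U x₀ * E| ≤ C₁ * (E / t) := by
    have : F' x₀ * δ - r * U x₀ * E = -(F x - F' x₀ * δ) + ((ρ (t ^ 2 + x) - r * D) * U x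
        + r * (D - E) * U x + r * E * (U x - U x₀)) := by
      rw [hFx hy0]
      ring
    rw [this]
    refine (abs_add_le _ _).trans ((add_le_add le_rfl (abs_add_three _ _ _)).trans ?_)
    rw [abs_neg]
    refine (add_le_add b0 (add_le_add (add_le_add b1 b2) b3)).trans (le_of_eq ?_)
    rw [hC₁]
    ring
  rw [e, abs_div, div_le_iff₀ hF'0]
  refine htot.trans (le_of_eq ?_)
  field_simp

lemma lt_of_interlacing {P q : ℕ → ℝ} (hq : StrictMono q)
    (h : ∀ i, ∃ m, P i < q m ∧ q m < P (i + 1)) (k : ℕ) : q k < P (k + 1) := by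
  have key : ∃ m, k ≤ m ∧ q m < P (k + 1) := by
    induction k with
    | zero =>
      obtain ⟨m, -, hm⟩ := h 0
      exact ⟨m, Nat.zero_le m, hm⟩
    | succ k ih =>
      obtain ⟨m, hkm, hm⟩ := ih
      obtain ⟨n, hn, hn'⟩ := h (k + 1)
      exact ⟨n, hkm.trans_lt (hq.lt_iff_lt.1 (hm.trans hn)), hn'⟩
  obtain ⟨m, hkm, hm⟩ := key
  exact (hq.monotone hkm).trans_lt hm

/-- The sequence `0, q 0, q 1, …`. -/
def consZero (q : ℕ → ℝ) : ℕ → ℝ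
  | 0 => 0
  | n + 1 => q n

lemma strictMono_consZero {q : ℕ → ℝ} (hq : StrictMono q) (h0 : ∀ n, 0 < q n) :
    StrictMono (consZero q) :=
  strictMono_nat_of_lt_succ fun n => by
    cases n with
    | zero => exact h0 0
    | succ n => exact hq n.lt_succ_self

lemma StrictMonoOn.strictMono_add_one {a : ℕ → ℝ} (ha : StrictMonoOn a (Ici 1)) :
    StrictMono fun i => a (i + 1) :=
  fun i j hij => ha (mem_Ici.2 (by omega)) (mem_Ici.2 (by omega)) (by omega)

/-- Sturm separation: if the Wronskian of `g₁`, `g₂` does not vanish, zeros of `g₁` are separated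
by zeros of `g₂`. -/
lemma exists_zero_between {g₁ g₂ g₁' g₂' : ℝ → ℝ} {p q : ℝ} (h₁ : ∀ x, HasDerivAt g₁ (g₁' x) x)
    (h₂ : ∀ x, HasDerivAt g₂ (g₂' x) x) (hpq : p < q) (hp : g₁ p = 0) (hq : g₁ q = 0)
    (hp' : g₂ p ≠ 0) (hq' : g₂ q ≠ 0)
    (hW : ∀ x ∈ Ioo p q, g₁ x * g₂' x - g₁' x * g₂ x ≠ 0) : ∃ z ∈ Ioo p q, g₂ z = 0 := by
  by_contra! h
  have hne : ∀ x ∈ Icc p q, g₂ x ≠ 0 := by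
    intro x hx
    rcases hx.1.eq_or_lt with rfl | hpx
    · exact hp'
    rcases hx.2.eq_or_lt with rfl | hxq
    · exact hq'
    exact h x ⟨hpx, hxq⟩
  obtain ⟨z, hz, hz0⟩ := exists_hasDerivAt_eq_zero (f := fun x => g₁ x / g₂ x)
    (f' := fun x => (g₁' x * g₂ x - g₁ x * g₂' x) / g₂ x ^ 2) hpq
    (fun x hx => ((h₁ x).continuousAt.div (h₂ x).continuousAt (hne x hx)).continuousWithinAt)
    (by simp [hp, hq])
    fun x hx => (h₁ x).div (h₂ x) (hne x (Ioo_subset_Icc_self hx))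
  have hz2 := pow_ne_zero 2 (hne z (Ioo_subset_Icc_self hz))
  rw [div_eq_zero_iff, or_iff_left hz2] at hz0
  exact hW z hz (by linarith)

lemma lt_of_sturm {g₁ g₂ g₁' g₂' : ℝ → ℝ} {P q : ℕ → ℝ} (h₁ : ∀ x, HasDerivAt g₁ (g₁' x) x)
    (h₂ : ∀ x, HasDerivAt g₂ (g₂' x) x) (hP : StrictMono P) (hP0 : 0 ≤ P 0) (hq : StrictMono q)
    (hzP : ∀ i, g₁ (-P i) = 0) (hzq : ∀ x, x < 0 → g₂ x = 0 → ∃ m, x = -q m)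
    (hend : ∀ i, g₂ (-P i) ≠ 0) (hW : ∀ x, x < 0 → g₁ x * g₂' x - g₁' x * g₂ x ≠ 0) (k : ℕ) :
    q k < P (k + 1) := by
  refine lt_of_interlacing hq (fun i => ?_) k
  have hPi : 0 ≤ P i := hP0.trans (hP.monotone (Nat.zero_le i))
  obtain ⟨z, hz, hz0⟩ := exists_zero_between h₁ h₂ (neg_lt_neg (hP i.lt_succ_self))
    (hzP (i + 1)) (hzP i) (hend (i + 1)) (hend i)
    fun x hx => hW x (hx.2.trans_le (neg_nonpos.2 hPi))
  obtain ⟨m, rfl⟩ := hzq z (hz.2.trans_le (neg_nonpos.2 hPi)) hz0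
  exact ⟨m, neg_lt_neg_iff.1 hz.2, neg_lt_neg_iff.1 hz.1⟩

lemma airyF_eq (U V : ℝ → ℝ) (x : ℝ) :
    AiF U V x = airyRec U V x / ((3:ℝ) ^ ((1:ℝ)/3) * Gamma (1/3)) := by
  have g1 : 0 < Gamma (1/3) := Gamma_pos_of_pos (by norm_num)
  have g2 : 0 < Gamma (2/3) := Gamma_pos_of_pos (by norm_num)
  have h3 : (3:ℝ) ^ ((2:ℝ)/3) = (3:ℝ) ^ ((1:ℝ)/3) * (3:ℝ) ^ ((1:ℝ)/3) := by
    rw [← rpow_add (by norm_num)]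
    norm_num
  have h4 : 0 < (3:ℝ) ^ ((1:ℝ)/3) := by positivity
  rw [AiF, airyRec, airyAlpha, h3]
  field_simp

lemma airyF_eq_zero_iff (U V : ℝ → ℝ) (x : ℝ) : AiF U V x = 0 ↔ airyRec U V x = 0 := by
  have g1 : 0 < Gamma (1/3) := Gamma_pos_of_pos (by norm_num)
  rw [airyF_eq, div_eq_zero_iff, or_iff_left (by positivity)]

lemma airyD_eq_zero_iff (U V : ℝ → ℝ) (x : ℝ) : AiD U V x = 0 ↔ airyRec U V x = 0 :=
  airyF_eq_zero_iff U V x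

namespace IsAiryBasis

variable {u v u' v' : ℝ → ℝ} {a ta cc tc : ℕ → ℝ}

lemma rec_ne_zero_of_rec' (H : IsAiryBasis u v u' v') {x : ℝ} (h : airyRec u' v' x = 0) :
    airyRec u v x ≠ 0 := fun h0 => by
  have := H.wronskian_rec x
  rw [h, h0] at this
  norm_num at this

lemma wronskian_rec_v (H : IsAiryBasis u v u' v') (x : ℝ) :
    airyRec u v x * v' x - airyRec u' v' x * v x = airyAlpha := by
  have := H.wronskian x
  simp only [airyRec]
  linear_combination airyAlpha * this

lemma zero_v_lt (H : IsAiryBasis u v u' v') (ha : ∀ k, 1 ≤ k → 0 < a k)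
    (ham : StrictMonoOn a (Ici 1)) (hza : ∀ k, 1 ≤ k → airyRec u v (-a k) = 0)
    (hc : StrictMono fun j => cc (2 * j + 1))
    (hzv : ∀ x, x < 0 → v x = 0 → ∃ j, x = -cc (2 * j + 1)) (j : ℕ) :
    cc (2 * j + 1) < a (j + 2) := by
  have hα := airyAlpha_pos.ne'
  refine lt_of_sturm (P := fun i => a (i + 1)) H.hasDerivAt_rec H.hasDerivAt_v
    ham.strictMono_add_one (ha 1 le_rfl).le hc (fun i => hza _ (by omega)) hzv (fun i h => ?_)
    (fun x _ => by rw [H.wronskian_rec_v]; exact hα) j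
  have := H.wronskian_rec_v (-a (i + 1))
  rw [hza _ (by omega), h] at this
  exact hα (by linarith)

lemma zero_v'_lt (H : IsAiryBasis u v u' v') (hta : ∀ k, 1 ≤ k → 0 < ta k)
    (htam : StrictMonoOn ta (Ici 1)) (hzta : ∀ k, 1 ≤ k → airyRec u' v' (-ta k) = 0)
    (hc : StrictMono fun j => cc (2 * j))
    (hzv' : ∀ x, v' x = 0 → ∃ j, x = -cc (2 * j)) (j : ℕ) :
    cc (2 * j) < ta (j + 2) := by
  have hα := airyAlpha_pos.ne'
  refine lt_of_sturm (P := fun i => ta (i + 1)) H.hasDerivAt_rec' H.hasDerivAt_v'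
    htam.strictMono_add_one (hta 1 le_rfl).le hc (fun i => hzta _ (by omega))
    (fun x _ => hzv' x) (fun i h => ?_) (fun x hx h => ?_) j
  · have := H.wronskian_rec_v (-ta (i + 1))
    rw [hzta _ (by omega), h] at this
    exact hα (by linarith)
  · have : x * airyAlpha = 0 := by
      linear_combination (-x) * H.wronskian_rec_v x - h
    exact mul_ne_zero hx.ne hα this

lemma lt_zero_u (H : IsAiryBasis u v u' v') (ham : StrictMonoOn a (Ici 1))
    (hza : ∀ x, airyRec u v x = 0 → ∃ k, 1 ≤ k ∧ x = -a k)
    (hc : StrictMono fun j => tc (2 * j)) (htc : ∀ p, 0 < tc p)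
    (hzu : ∀ j, u (-tc (2 * j)) = 0) (k : ℕ) :
    a (k + 1) < tc (2 * (k + 1)) := by
  refine lt_of_sturm (q := fun i => a (i + 1)) H.hasDerivAt_u H.hasDerivAt_rec hc
    (htc _).le ham.strictMono_add_one hzu (fun x _ hx => ?_) (fun i h => ?_) (fun x _ h => ?_) k
  · obtain ⟨k, hk, rfl⟩ := hza x hx
    exact ⟨k - 1, by simp [Nat.sub_add_cancel hk]⟩
  · have := H.wronskian_rec (-tc (2 * i))
    rw [hzu, h] at this
    norm_num at this
  · linarith [H.wronskian_rec x]

lemma lt_zero_u' (H : IsAiryBasis u v u' v') (htam : StrictMonoOn ta (Ici 1))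
    (hzta : ∀ x, airyRec u' v' x = 0 → ∃ k, 1 ≤ k ∧ x = -ta k)
    (hc : StrictMono fun j => tc (2 * j + 1)) (htc : ∀ p, 0 < tc p)
    (hzu' : ∀ j, u' (-tc (2 * j + 1)) = 0) (k : ℕ) :
    ta (k + 1) < tc (2 * k + 1) := by
  have hz : ∀ i, u' (-consZero (fun j => tc (2 * j + 1)) i) = 0 := fun i => by
    cases i with
    | zero => simp [consZero, H.u'_zero]
    | succ i => exact hzu' i
  refine lt_of_sturm (P := consZero fun j => tc (2 * j + 1)) (q := fun i => ta (i + 1))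
    H.hasDerivAt_u' H.hasDerivAt_rec' (strictMono_consZero hc fun j => htc _) le_rfl
    htam.strictMono_add_one hz (fun x _ hx => ?_) (fun i h => ?_) (fun x hx h => ?_) k
  · obtain ⟨k, hk, rfl⟩ := hzta x hx
    exact ⟨k - 1, by simp [Nat.sub_add_cancel hk]⟩
  · have := H.wronskian_rec (-consZero (fun j => tc (2 * j + 1)) i)
    rw [hz, h] at this
    norm_num at this
  · exact hx.ne (by linear_combination h - x * H.wronskian_rec x)

lemma zero_rec'_lt_zero_rec (H : IsAiryBasis u v u' v') (ha : ∀ k, 1 ≤ k → 0 < a k)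
    (ham : StrictMonoOn a (Ici 1)) (htam : StrictMonoOn ta (Ici 1))
    (hza : ∀ k, 1 ≤ k → airyRec u v (-a k) = 0)
    (hzta : ∀ x, airyRec u' v' x = 0 → ∃ k, 1 ≤ k ∧ x = -ta k) (k : ℕ) :
    ta (k + 1) < a (k + 1) := by
  have key : ∀ x, airyRec u' v' x = 0 → ∃ m, x = -ta (m + 1) := fun x hx => by
    obtain ⟨k, hk, rfl⟩ := hzta x hx
    exact ⟨k - 1, by simp [Nat.sub_add_cancel hk]⟩
  refine lt_of_interlacing (P := consZero fun i => a (i + 1)) (q := fun i => ta (i + 1))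
    htam.strictMono_add_one (fun i => ?_) k
  have hcont : ∀ p q, ContinuousOn (airyRec u v) (Icc p q) :=
    fun p q x _ => (H.hasDerivAt_rec x).continuousAt.continuousWithinAt
  suffices ∃ z ∈ Ioo (-consZero (fun i => a (i + 1)) (i + 1)) (-consZero (fun i => a (i + 1)) i),
      airyRec u' v' z = 0 by
    obtain ⟨z, hz, hz0⟩ := this
    obtain ⟨m, rfl⟩ := key z hz0
    exact ⟨m, neg_lt_neg_iff.1 hz.2, neg_lt_neg_iff.1 hz.1⟩
  cases i with
  | zero =>
    have ha1 : -a 1 < 0 := neg_lt_zero.2 (ha 1 le_rfl)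
    simp only [consZero, neg_zero, zero_add]
    by_contra! h
    have hcont' : ContinuousOn (airyRec u' v') (Icc (-a 1) 0) :=
      fun x _ => (H.hasDerivAt_rec' x).continuousAt.continuousWithinAt
    have hneg : ∀ x ∈ Ioo (-a 1) 0, airyRec u' v' x < 0 := by
      intro x hx
      by_contra! hx0
      obtain ⟨z, hz, hz0⟩ := intermediate_value_Icc' hx.2.le
        (hcont'.mono (Icc_subset_Icc_left hx.1.le))
        (show (0:ℝ) ∈ _ from ⟨by simp [airyRec, H.u'_zero, H.v'_zero], hx0⟩)
      rcases hz.2.eq_or_lt with rfl | hz'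
      · simp [airyRec, H.u'_zero, H.v'_zero] at hz0
      · exact h z ⟨hx.1.trans_le hz.1, hz'⟩ hz0
    obtain ⟨z, hz, hz'⟩ := exists_hasDerivAt_eq_slope (airyRec u v) (airyRec u' v') ha1
      (hcont _ _) fun x _ => H.hasDerivAt_rec x
    have h1 := hneg z hz
    rw [hz', hza 1 le_rfl] at h1
    have h2 : airyRec u v 0 = airyAlpha := by simp [airyRec, H.u_zero, H.v_zero]
    have h3 := airyAlpha_pos
    rw [h2] at h1
    have : 0 < (airyAlpha - 0) / (0 - -a 1) := div_pos (by linarith) (by linarith)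
    linarith
  | succ i =>
    exact exists_hasDerivAt_eq_zero (neg_lt_neg (ham.strictMono_add_one i.lt_succ_self))
      (hcont _ _) (by simp [consZero, hza]) fun x _ => H.hasDerivAt_rec x

lemma zero_rec_lt_zero_rec' (H : IsAiryBasis u v u' v') (hta : ∀ k, 1 ≤ k → 0 < ta k)
    (ham : StrictMonoOn a (Ici 1)) (htam : StrictMonoOn ta (Ici 1))
    (hzta : ∀ k, 1 ≤ k → airyRec u' v' (-ta k) = 0)
    (hza : ∀ x, airyRec u v x = 0 → ∃ k, 1 ≤ k ∧ x = -a k) (k : ℕ) :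
    a (k + 1) < ta (k + 2) := by
  refine lt_of_interlacing (P := fun i => ta (i + 1)) (q := fun i => a (i + 1))
    ham.strictMono_add_one (fun i => ?_) k
  obtain ⟨z, hz, hz0⟩ := exists_hasDerivAt_eq_zero
    (neg_lt_neg (htam.strictMono_add_one i.lt_succ_self))
    (fun x _ => (H.hasDerivAt_rec' x).continuousAt.continuousWithinAt)
    (by rw [hzta _ (by omega), hzta _ (by omega)]) fun x _ => H.hasDerivAt_rec' x
  have hz1 : z < 0 := hz.2.trans (neg_lt_zero.2 (hta _ (by omega)))
  obtain ⟨m, hm, rfl⟩ := hza z ((mul_eq_zero.1 hz0).resolve_left hz1.ne)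
  refine ⟨m - 1, ?_⟩
  simp only [Nat.sub_add_cancel hm]
  exact ⟨neg_lt_neg_iff.1 hz.2, neg_lt_neg_iff.1 hz.1⟩

end IsAiryBasis

lemma airyRec_eq_div_mul {n d U V α : ℝ} (hd : d ≠ 0) (h : n * U = d * V) :
    α * U - V = (α * d - n) / d * U := by
  field_simp
  linear_combination h

lemma width_bound_of_airyDecayLin {h A b E₂ E₃ σ C₂ C₃ : ℝ} (hh : 0 < h)
    (h₂ : |(-(h ^ (-(2:ℝ)/3)) - E₂) - -b|
      ≤ C₂ * (airyDecayLin (-A) (h ^ (-(1:ℝ)/3)) / h ^ (-(1:ℝ)/3)))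
    (h₃ : |((-(h ^ (-(2:ℝ)/3)) - E₃) - -A) - σ * airyDecayLin (-A) (h ^ (-(1:ℝ)/3))|
      ≤ C₃ * (airyDecayLin (-A) (h ^ (-(1:ℝ)/3)) / h ^ (-(1:ℝ)/3))) :
    |(E₃ - E₂) - (A - b) + σ * exp (-4/(3*h) + 2 * A * h ^ (-(1:ℝ)/3))|
      ≤ (C₂ + C₃) * h ^ ((1:ℝ)/3) * exp (-4/(3*h) + 2 * A * h ^ (-(1:ℝ)/3)) := by
  have e1 : h ^ ((1:ℝ)/3) = 1 / h ^ (-(1:ℝ)/3) := by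
    rw [neg_div, rpow_neg hh.le, div_inv_eq_mul, one_mul]
  have e2 : (h ^ (-(1:ℝ)/3)) ^ 3 = 1 / h := by
    rw [← rpow_natCast, ← rpow_mul hh.le]
    norm_num [rpow_neg_one]
  have e3 : exp (-4/(3*h) + 2 * A * h ^ (-(1:ℝ)/3)) = airyDecayLin (-A) (h ^ (-(1:ℝ)/3)) := by
    rw [airyDecayLin, e2]
    congr 1
    field_simp
    ring
  rw [e3, e1]
  set E := airyDecayLin (-A) (h ^ (-(1:ℝ)/3))
  have e4 : (E₃ - E₂) - (A - b) + σ * E = ((-(h ^ (-(2:ℝ)/3)) - E₂) - -b)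
      - (((-(h ^ (-(2:ℝ)/3)) - E₃) - -A) - σ * E) := by ring
  rw [e4]
  refine (abs_sub _ _).trans ((add_le_add h₂ h₃).trans (le_of_eq ?_))
  ring

lemma neg_eq_sq_add {h E : ℝ} (hh : 0 < h) :
    (h ^ (-(1:ℝ)/3)) ^ 2 + (-(h ^ (-(2:ℝ)/3)) - E) = -E := by
  have : (h ^ (-(1:ℝ)/3)) ^ 2 = h ^ (-(2:ℝ)/3) := by
    rw [← rpow_natCast, ← rpow_mul hh.le]
    norm_num
  rw [this]
  ring

namespace IsAiryBasis

variable {u v u' v' : ℝ → ℝ}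

lemma continuous_u (H : IsAiryBasis u v u' v') : Continuous u :=
  continuous_iff_continuousAt.2 fun x => (H.hasDerivAt_u x).continuousAt

lemma continuous_u' (H : IsAiryBasis u v u' v') : Continuous u' :=
  continuous_iff_continuousAt.2 fun x => (H.hasDerivAt_u' x).continuousAt

lemma continuous_rec (H : IsAiryBasis u v u' v') : Continuous (airyRec u v) :=
  continuous_iff_continuousAt.2 fun x => (H.hasDerivAt_rec x).continuousAt

lemma continuous_rec' (H : IsAiryBasis u v u' v') : Continuous (airyRec u' v') :=
  continuous_iff_continuousAt.2 fun x => (H.hasDerivAt_rec' x).continuousAt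

lemma rec_div_le (H : IsAiryBasis u v u' v') (hf : ∀ x, 0 ≤ x → airyRec u v x ≠ 0)
    (hf' : ∀ x, 0 ≤ x → airyRec u' v' x ≠ 0) :
    ∃ B Y : ℝ, 0 < B ∧ ∀ y, Y ≤ y → |airyRec u v y / u y| ≤ B * airyDecay y := by
  obtain ⟨C, Y, hC, hY, h⟩ := H.rec_div_asymptotic hf hf'
  have hα := airyAlpha_pos
  refine ⟨C + √3 * airyAlpha, Y, by positivity, fun y hy => ?_⟩
  have hD := airyDecay_pos y
  have h1 := abs_add_le (airyRec u v y / u y - √3 * airyAlpha * airyDecay y)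
    (√3 * airyAlpha * airyDecay y)
  rw [sub_add_cancel, abs_of_pos (by positivity : 0 < √3 * airyAlpha * airyDecay y)] at h1
  have h2 : airyDecay y / √y ≤ airyDecay y :=
    div_le_self hD.le (le_sqrt_of_sq_le (by linarith))
  have h3 := mul_le_mul_of_nonneg_left h2 hC.le
  linarith [h y hy]

/-- Width of the even gaps, given uniqueness of the zeros of `α u - v` and `α u' - v'` in the
relevant intervals. -/
lemma even_width (H : IsAiryBasis u v u' v') (hf : ∀ x, 0 ≤ x → airyRec u v x ≠ 0)
    (hf' : ∀ x, 0 ≤ x → airyRec u' v' x ≠ 0) {A b p q : ℝ} (hb : 0 < b) (hbA : b < A)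
    (hA0 : airyRec u v (-A) = 0) (hb0 : airyRec u' v' (-b) = 0)
    (hA : ∀ x ∈ Icc (-A) q, airyRec u v x = 0 → x = -A)
    (hB : ∀ x ∈ Icc p (-b), airyRec u' v' x = 0 → x = -b) :
    ∃ C : ℝ, 0 < C ∧ ∀ h : ℝ, 0 < h → ∀ E₂ E₃ : ℝ, E₂ ≤ 0 → E₃ ≤ 0 →
      -(h ^ (-(2:ℝ)/3)) - E₂ ∈ Icc p (-b) →
      v (-E₂) * u' (-(h ^ (-(2:ℝ)/3)) - E₂) = u (-E₂) * v' (-(h ^ (-(2:ℝ)/3)) - E₂) →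
      -(h ^ (-(2:ℝ)/3)) - E₃ ∈ Icc (-A) q →
      v' (-E₃) * u (-(h ^ (-(2:ℝ)/3)) - E₃) = u' (-E₃) * v (-(h ^ (-(2:ℝ)/3)) - E₃) →
      |(E₃ - E₂) - (A - b)
          + √3 * airyAlpha * u (-A) ^ 2 * exp (-4/(3*h) + 2 * A * h ^ (-(1:ℝ)/3))|
        ≤ C * h ^ ((1:ℝ)/3) * exp (-4/(3*h) + 2 * A * h ^ (-(1:ℝ)/3)) := by
  obtain ⟨B₂, Y₂, hB₂, hρ₂⟩ := H.rec_div_le hf hf'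
  obtain ⟨B₃, Y₃, hB₃, hY₃, hρ₃⟩ := H.rec'_div_asymptotic hf hf'
  have hwA := H.wronskian_rec (-A)
  rw [hA0, zero_mul, zero_sub] at hwA
  have hrA : airyRec u' v' (-A) ≠ 0 := fun h => by simp [h] at hwA
  obtain ⟨C₂, hC₂, h₂⟩ := exists_abs_sub_le_airyDecayLin (x₀ := -A) H.hasDerivAt_rec'
    H.continuous_u' (neg_lt_neg hbA) hb0
    (mul_ne_zero (neg_ne_zero.2 hb.ne') (H.rec_ne_zero_of_rec' hb0)) hB hB₂ hρ₂
  obtain ⟨C₃, hC₃, h₃⟩ := exists_abs_sub_sub_le_airyDecayLin (r := -(√3 * airyAlpha))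
    (ρ := fun y => airyRec u' v' y / u' y) H.hasDerivAt_rec
    H.hasDerivAt_rec' (continuous_id.mul H.continuous_rec) H.hasDerivAt_u H.continuous_u' hA0 hrA
    hA hB₃ hY₃ fun y hy => by
      have := hρ₃ y hy
      rwa [neg_mul, sub_neg_eq_add]
  have hσ : -(√3 * airyAlpha) * u (-A) / airyRec u' v' (-A) = √3 * airyAlpha * u (-A) ^ 2 := by
    rw [div_eq_iff hrA]
    linear_combination (√3 * airyAlpha * u (-A)) * hwA
  refine ⟨C₂ + C₃, by positivity, fun h hh E₂ E₃ hE₂ hE₃ m₂ e₂ m₃ e₃ => ?_⟩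
  have ht : 0 < h ^ (-(1:ℝ)/3) := rpow_pos_of_pos hh _
  rw [← hσ]
  refine width_bound_of_airyDecayLin hh (h₂ _ ht _ ⟨m₂, fun hy => ?_⟩) (h₃ _ ht _ ⟨m₃, fun hy => ?_⟩)
  · rw [neg_eq_sq_add hh] at hy ⊢
    exact airyRec_eq_div_mul (H.u_pos hy.le).ne' e₂
  · rw [neg_eq_sq_add hh] at hy ⊢
    exact airyRec_eq_div_mul (H.u'_pos hy).ne' e₃

/-- Width of the odd gaps, given uniqueness of the zeros of `α u - v` and `α u' - v'` in the
relevant intervals. -/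
lemma odd_width (H : IsAiryBasis u v u' v') (hf : ∀ x, 0 ≤ x → airyRec u v x ≠ 0)
    (hf' : ∀ x, 0 ≤ x → airyRec u' v' x ≠ 0) {A b p q : ℝ} (hb : 0 < b) (hbA : b < A)
    (hA0 : airyRec u' v' (-A) = 0) (hb0 : airyRec u v (-b) = 0)
    (hA : ∀ x ∈ Icc (-A) q, airyRec u' v' x = 0 → x = -A)
    (hB : ∀ x ∈ Icc p (-b), airyRec u v x = 0 → x = -b) :
    ∃ C : ℝ, 0 < C ∧ ∀ h : ℝ, 0 < h → ∀ E₂ E₃ : ℝ, E₂ ≤ 0 → E₃ ≤ 0 →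
      -(h ^ (-(2:ℝ)/3)) - E₂ ∈ Icc p (-b) →
      u (-E₂) * v (-(h ^ (-(2:ℝ)/3)) - E₂) = v (-E₂) * u (-(h ^ (-(2:ℝ)/3)) - E₂) →
      -(h ^ (-(2:ℝ)/3)) - E₃ ∈ Icc (-A) q →
      u' (-(h ^ (-(2:ℝ)/3)) - E₃) * v' (-E₃) = v' (-(h ^ (-(2:ℝ)/3)) - E₃) * u' (-E₃) →
      |(E₃ - E₂) - (A - b)
          + √3 * airyAlpha * u' (-A) ^ 2 / A * exp (-4/(3*h) + 2 * A * h ^ (-(1:ℝ)/3))|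
        ≤ C * h ^ ((1:ℝ)/3) * exp (-4/(3*h) + 2 * A * h ^ (-(1:ℝ)/3)) := by
  obtain ⟨B₂, Y₂, hB₂, hρ₂⟩ := H.rec_div_le hf hf'
  obtain ⟨B₃, Y₃, hB₃, hY₃, hρ₃⟩ := H.rec'_div_asymptotic hf hf'
  have hA1 : 0 < A := hb.trans hbA
  have hwA := H.wronskian_rec (-A)
  rw [hA0, zero_mul, sub_zero] at hwA
  have hwb := H.wronskian_rec (-b)
  rw [hb0, zero_mul, zero_sub] at hwb
  have hrb : airyRec u' v' (-b) ≠ 0 := fun h => by simp [h] at hwb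
  have hrA := H.rec_ne_zero_of_rec' hA0
  have hrA' : -A * airyRec u v (-A) ≠ 0 := mul_ne_zero (neg_ne_zero.2 hA1.ne') hrA
  obtain ⟨C₂, hC₂, h₂⟩ := exists_abs_sub_le_airyDecayLin (x₀ := -A) H.hasDerivAt_rec
    H.continuous_u (neg_lt_neg hbA) hb0 hrb hB hB₂ hρ₂
  obtain ⟨C₃, hC₃, h₃⟩ := exists_abs_sub_sub_le_airyDecayLin (r := -(√3 * airyAlpha))
    (ρ := fun y => airyRec u' v' y / u' y) H.hasDerivAt_rec'
    (fun x => (hasDerivAt_id x).mul (H.hasDerivAt_rec x))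
    ((continuous_const.mul H.continuous_rec).add (continuous_id.mul H.continuous_rec'))
    H.hasDerivAt_u' (continuous_id.mul H.continuous_u) hA0 hrA'
    hA hB₃ hY₃ fun y hy => by
      have := hρ₃ y hy
      rwa [neg_mul, sub_neg_eq_add]
  have hσ : -(√3 * airyAlpha) * u' (-A) / (-A * airyRec u v (-A))
      = √3 * airyAlpha * u' (-A) ^ 2 / A := by
    rw [div_eq_div_iff hrA' hA1.ne']
    linear_combination (√3 * airyAlpha * u' (-A) * A) * hwA
  refine ⟨C₂ + C₃, by positivity, fun h hh E₂ E₃ hE₂ hE₃ m₂ e₂ m₃ e₃ => ?_⟩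
  have ht : 0 < h ^ (-(1:ℝ)/3) := rpow_pos_of_pos hh _
  rw [← hσ]
  refine width_bound_of_airyDecayLin hh (h₂ _ ht _ ⟨m₂, fun hy => ?_⟩) (h₃ _ ht _ ⟨m₃, fun hy => ?_⟩)
  · rw [neg_eq_sq_add hh] at hy ⊢
    exact airyRec_eq_div_mul (H.u_pos hy.le).ne' e₂.symm
  · rw [neg_eq_sq_add hh] at hy ⊢
    exact airyRec_eq_div_mul (H.u'_pos hy).ne' (by linear_combination e₃)

end IsAiryBasis

theorem stmt_17 (u v u' v' : ℝ → ℝ)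
    (hu : ∀ x, HasDerivAt u (u' x) x)
    (huAiry : ∀ x, HasDerivAt u' (x * u x) x)
    (hv : ∀ x, HasDerivAt v (v' x) x)
    (hvAiry : ∀ x, HasDerivAt v' (x * v x) x)
    (hu0 : u 0 = 1) (hu'0 : u' 0 = 0) (hv0 : v 0 = 0) (hv'0 : v' 0 = 1)
    (a ta : ℕ → ℝ) (cc tc : ℕ → ℝ)
    (hapos : ∀ k, 1 ≤ k → 0 < a k) (htapos : ∀ k, 1 ≤ k → 0 < ta k)
    (hamono : StrictMonoOn a (Ici 1)) (htamono : StrictMonoOn ta (Ici 1))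
    (hccpos : ∀ p, 0 < cc p) (htcpos : ∀ p, 0 < tc p)
    (hcc_even_mono : StrictMono (fun j => cc (2*j)))
    (hcc_odd_mono : StrictMono (fun j => cc (2*j+1)))
    (htc_even_mono : StrictMono (fun j => tc (2*j)))
    (htc_odd_mono : StrictMono (fun j => tc (2*j+1)))
    (hzAi : ∀ x : ℝ, AiF u v x = 0 ↔ ∃ k, 1 ≤ k ∧ x = -a k)
    (hzAi' : ∀ x : ℝ, AiD u' v' x = 0 ↔ ∃ k, 1 ≤ k ∧ x = -ta k)
    (hzv' : ∀ x : ℝ, v' x = 0 ↔ ∃ j : ℕ, x = -cc (2*j))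
    (hzv : ∀ x : ℝ, x < 0 → (v x = 0 ↔ ∃ j : ℕ, x = -cc (2*j+1)))
    (hzu : ∀ x : ℝ, u x = 0 ↔ ∃ j : ℕ, x = -tc (2*j))
    (hzu' : ∀ x : ℝ, x < 0 → (u' x = 0 ↔ ∃ j : ℕ, x = -tc (2*j+1))) :
    -- Even gaps: width γ_{2j} of the (2j)-th rescaled spectral gap
    (∀ j : ℕ, ∀ τ : ℝ, 0 < τ → ∃ C : ℝ, 0 < C ∧
      ∀ h : ℝ, h ∈ Ioc (0:ℝ) ((a (j+1) + τ) ^ (-(3:ℝ)/2)) →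
        ∀ E₂ E₃ : ℝ, E₂ ≤ 0 → E₃ ≤ 0 →
          -(cc (2*j)) ≤ -(h ^ (-(2:ℝ)/3)) - E₂ →
          -(h ^ (-(2:ℝ)/3)) - E₂ < -(ta (j+1)) →
          v (-E₂) * u' (-(h ^ (-(2:ℝ)/3)) - E₂)
            = u (-E₂) * v' (-(h ^ (-(2:ℝ)/3)) - E₂) →
          -(a (j+1)) < -(h ^ (-(2:ℝ)/3)) - E₃ →
          -(h ^ (-(2:ℝ)/3)) - E₃ ≤ -(tc (2*j)) →
          v' (-E₃) * u (-(h ^ (-(2:ℝ)/3)) - E₃)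
            = u' (-E₃) * v (-(h ^ (-(2:ℝ)/3)) - E₃) →
          |(E₃ - E₂) - (a (j+1) - ta (j+1))
              + Real.sqrt 3 * airyAlpha * (u (-(a (j+1)))) ^ 2
                * Real.exp (-4/(3*h) + 2 * a (j+1) * h ^ (-(1:ℝ)/3))|
            ≤ C * h ^ ((1:ℝ)/3)
                * Real.exp (-4/(3*h) + 2 * a (j+1) * h ^ (-(1:ℝ)/3))) ∧
    -- Odd gaps: width γ_{2j+1} of the (2j+1)-th rescaled spectral gap
    (∀ j : ℕ, ∀ τ : ℝ, 0 < τ → ∃ C : ℝ, 0 < C ∧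
      ∀ h : ℝ, h ∈ Ioc (0:ℝ) ((ta (j+2) + τ) ^ (-(3:ℝ)/2)) →
        ∀ E₂ E₃ : ℝ, E₂ ≤ 0 → E₃ ≤ 0 →
          -(cc (2*j+1)) ≤ -(h ^ (-(2:ℝ)/3)) - E₂ →
          -(h ^ (-(2:ℝ)/3)) - E₂ < -(a (j+1)) →
          u (-E₂) * v (-(h ^ (-(2:ℝ)/3)) - E₂)
            = v (-E₂) * u (-(h ^ (-(2:ℝ)/3)) - E₂) →
          -(ta (j+2)) < -(h ^ (-(2:ℝ)/3)) - E₃ →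
          -(h ^ (-(2:ℝ)/3)) - E₃ ≤ -(tc (2*j+1)) →
          u' (-(h ^ (-(2:ℝ)/3)) - E₃) * v' (-E₃)
            = v' (-(h ^ (-(2:ℝ)/3)) - E₃) * u' (-E₃) →
          |(E₃ - E₂) - (ta (j+2) - a (j+1))
              + Real.sqrt 3 * airyAlpha * (u' (-(ta (j+2)))) ^ 2 / ta (j+2)
                * Real.exp (-4/(3*h) + 2 * ta (j+2) * h ^ (-(1:ℝ)/3))|
            ≤ C * h ^ ((1:ℝ)/3)
                * Real.exp (-4/(3*h) + 2 * ta (j+2) * h ^ (-(1:ℝ)/3))) := by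
  have H : IsAiryBasis u v u' v' := ⟨hu, huAiry, hv, hvAiry, hu0, hu'0, hv0, hv'0⟩
  simp only [airyF_eq_zero_iff] at hzAi
  simp only [airyD_eq_zero_iff] at hzAi'
  have hf : ∀ x, 0 ≤ x → airyRec u v x ≠ 0 := fun x hx h => by
    obtain ⟨k, hk, rfl⟩ := (hzAi x).1 h
    linarith [hapos k hk]
  have hf' : ∀ x, 0 ≤ x → airyRec u' v' x ≠ 0 := fun x hx h => by
    obtain ⟨k, hk, rfl⟩ := (hzAi' x).1 h
    linarith [htapos k hk]
  have za : ∀ k, 1 ≤ k → airyRec u v (-a k) = 0 := fun k hk => (hzAi _).2 ⟨k, hk, rfl⟩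
  have zta : ∀ k, 1 ≤ k → airyRec u' v' (-ta k) = 0 := fun k hk => (hzAi' _).2 ⟨k, hk, rfl⟩
  refine ⟨fun j τ _ => ?_, fun j τ _ => ?_⟩
  · obtain ⟨C, hC, hw⟩ := H.even_width hf hf' (p := -cc (2 * j)) (q := -tc (2 * j))
      (htapos (j + 1) (by omega))
      (H.zero_rec'_lt_zero_rec hapos hamono htamono za (fun x => (hzAi' x).1) j)
      (za (j + 1) (by omega)) (zta (j + 1) (by omega))
      (fun x hx h0 => by
        obtain ⟨k, hk, rfl⟩ := (hzAi x).1 h0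
        rw [show k = j + 1 from ?_]
        have h1 : k ≤ j + 1 :=
          (hamono.le_iff_le hk (mem_Ici.2 (by omega))).1 (neg_le_neg_iff.1 hx.1)
        by_contra h2
        obtain ⟨i, rfl⟩ : ∃ i, j = i + 1 := ⟨j - 1, by omega⟩
        have h3 := H.lt_zero_u hamono (fun x => (hzAi x).1) htc_even_mono htcpos
          (fun j => (hzu _).2 ⟨j, rfl⟩) i
        have h4 : a k ≤ a (i + 1) :=
          hamono.monotoneOn hk (mem_Ici.2 (by omega)) (by omega)
        linarith [hx.2])
      (fun x hx h0 => by
        obtain ⟨k, hk, rfl⟩ := (hzAi' x).1 h0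
        rw [show k = j + 1 from ?_]
        have h1 : j + 1 ≤ k :=
          (htamono.le_iff_le (mem_Ici.2 (by omega)) hk).1 (neg_le_neg_iff.1 hx.2)
        by_contra h2
        have h3 := H.zero_v'_lt htapos htamono zta hcc_even_mono (fun x => (hzv' x).1) j
        have h4 : ta (j + 2) ≤ ta k :=
          htamono.monotoneOn (mem_Ici.2 (by omega)) hk (by omega)
        linarith [hx.1])
    exact ⟨C, hC, fun h hh E₂ E₃ hE₂ hE₃ p₂ q₂ e₂ p₃ q₃ e₃ =>
      hw h hh.1 E₂ E₃ hE₂ hE₃ ⟨p₂, q₂.le⟩ e₂ ⟨p₃.le, q₃⟩ e₃⟩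
  · obtain ⟨C, hC, hw⟩ := H.odd_width hf hf' (p := -cc (2 * j + 1)) (q := -tc (2 * j + 1))
      (hapos (j + 1) (by omega))
      (H.zero_rec_lt_zero_rec' htapos hamono htamono zta (fun x => (hzAi x).1) j)
      (zta (j + 2) (by omega)) (za (j + 1) (by omega))
      (fun x hx h0 => by
        obtain ⟨k, hk, rfl⟩ := (hzAi' x).1 h0
        rw [show k = j + 2 from ?_]
        have h1 : k ≤ j + 2 :=
          (htamono.le_iff_le hk (mem_Ici.2 (by omega))).1 (neg_le_neg_iff.1 hx.1)
        by_contra h2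
        have h3 := H.lt_zero_u' htamono (fun x => (hzAi' x).1) htc_odd_mono htcpos
          (fun j => (hzu' _ (neg_lt_zero.2 (htcpos _))).2 ⟨j, rfl⟩) j
        have h4 : ta k ≤ ta (j + 1) :=
          htamono.monotoneOn hk (mem_Ici.2 (by omega)) (by omega)
        linarith [hx.2])
      (fun x hx h0 => by
        obtain ⟨k, hk, rfl⟩ := (hzAi x).1 h0
        rw [show k = j + 1 from ?_]
        have h1 : j + 1 ≤ k :=
          (hamono.le_iff_le (mem_Ici.2 (by omega)) hk).1 (neg_le_neg_iff.1 hx.2)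
        by_contra h2
        have h3 := H.zero_v_lt hapos hamono za hcc_odd_mono (fun x hx => (hzv x hx).1) j
        have h4 : a (j + 2) ≤ a k :=
          hamono.monotoneOn (mem_Ici.2 (by omega)) hk (by omega)
        linarith [hx.1])
    exact ⟨C, hC, fun h hh E₂ E₃ hE₂ hE₃ p₂ q₂ e₂ p₃ q₃ e₃ =>
      hw h hh.1 E₂ E₃ hE₂ hE₃ ⟨p₂, q₂.le⟩ e₂ ⟨p₃.le, q₃⟩ e₃⟩
end

section
/- Let a < b be real numbers and let q₁, q₂, g : ℝ → ℝ be continuous on [a,b] and continuously differentiable on (a,b), with q₁(x) > q₂(x) > 0 for every x in [a,b]. Let z, y : ℝ → ℝ be continuously differentiable on [a,b] such that q₁·z' and q₂·y' are differentiable on [a,b] with (q₁·z')'(x) = g(x)·z(x) and (q₂·y')'(x) = g(x)·y(x) for all x in [a,b], and assume y(x) > 0 for all x in [a,b]. Then: (i) for every x in (a,b), the derivative at x of the function t ↦ (z(t)/y(t))·(q₁(t)·y(t)·z'(t) − q₂(t)·y'(t)·z(t)) equals (q₁(x) − q₂(x))·(z'(x))² + q₂(x)·(z'(x) − y'(x)·z(x)/y(x))²;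 (ii) if moreover there exists η > 0 with q₁(x) − q₂(x) > η for all x in [a,b], and z(a) = 0 or z(b) = 0, then there exists A > 0 such that F(b) − F(a) ≥ A·∫ₐᵇ (z(x))² dx, where F(t) = (z(t)/y(t))·(q₁(t)·y(t)·z'(t) − q₂(t)·y'(t)·z(t)). -/
open Real Set intervalIntegral

/-- The **Sturm–Picone identity** within a set, at a point where the denominator is nonzero. -/
theorem picone_hasDerivWithinAt {q₁ q₂ z y z' y' : ℝ → ℝ} {g x : ℝ} {s : Set ℝ}
    (hz : HasDerivWithinAt z (z' x) s x) (hy : HasDerivWithinAt y (y' x) s x)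
    (hzeq : HasDerivWithinAt (fun t => q₁ t * z' t) (g * z x) s x)
    (hyeq : HasDerivWithinAt (fun t => q₂ t * y' t) (g * y x) s x) (hyx : y x ≠ 0) :
    HasDerivWithinAt (fun t => z t / y t * (q₁ t * y t * z' t - q₂ t * y' t * z t))
      ((q₁ x - q₂ x) * (z' x) ^ 2 + q₂ x * (z' x - y' x * z x / y x) ^ 2) s x := by
  have h := (hz.fun_div hy hyx).fun_mul ((hy.fun_mul hzeq).fun_sub (hyeq.fun_mul hz))
  refine (h.congr_deriv ?_).congr_of_eventuallyEq (.of_forall fun t => ?_) ?_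
  · field_simp
    ring
  all_goals ring

/-- If `F' ≥ η z'²` and `z` vanishes at an endpoint of `[a, b]`, then the increment of `F`
dominates a multiple of `∫ z²`, by a Poincaré-type inequality. The Poincaré weight is linear and
vanishes at the other endpoint. -/
theorem const_mul_integral_sq_le_sub {a b η : ℝ} (hab : a < b) (hη : 0 < η) {F F' z z' : ℝ → ℝ}
    (hF : ∀ x ∈ Icc a b, HasDerivWithinAt F (F' x) (Icc a b) x)
    (hz : ∀ x ∈ Icc a b, HasDerivWithinAt z (z' x) (Icc a b) x)
    (hle : ∀ x ∈ Icc a b, η * z' x ^ 2 ≤ F' x) (h0 : z a = 0 ∨ z b = 0) :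
    η / (4 * (b - a) ^ 2) * ∫ x in a..b, z x ^ 2 ≤ F b - F a := by
  obtain ⟨e, he, hea, heb⟩ : ∃ e ∈ Icc a b, (e - a) * z a ^ 2 = 0 ∧ (e - b) * z b ^ 2 = 0 := by
    rcases h0 with h | h
    · exact ⟨b, right_mem_Icc.2 hab.le, by simp [h], by simp⟩
    · exact ⟨a, left_mem_Icc.2 hab.le, by simp, by simp [h]⟩
  have hL : 0 < b - a := sub_pos.2 hab
  obtain ⟨m, hm⟩ : ∃ m, m = 1 / (2 * (b - a) ^ 2) := ⟨_, rfl⟩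
  have hmL : m * (b - a) ^ 2 = 1 / 2 := by rw [hm]; field_simp
  have hc : η / (4 * (b - a) ^ 2) = η * (m / 2) := by rw [hm]; field_simp; norm_num
  have hm0 : 0 < m := by rw [hm]; positivity
  have hG : ∀ x ∈ Icc a b, HasDerivWithinAt (fun t => F t - η * m * ((e - t) * z t ^ 2))
      (F' x - η * m * (-z x ^ 2 + (e - x) * (2 * z x * z' x))) (Icc a b) x := by
    intro x hx
    have h := (((hasDerivWithinAt_id x (Icc a b)).const_sub e).fun_mul
      ((hz x hx).fun_pow 2)).const_mul (η * m)
    refine ((hF x hx).fun_sub h).congr_deriv ?_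
    simp
  have hzc : ContinuousOn (fun x => η * (m / 2) * z x ^ 2) (Icc a b) :=
    continuousOn_const.mul (ContinuousOn.pow (fun x hx => (hz x hx).continuousWithinAt) 2)
  have key := integral_le_sub_of_hasDeriv_right_of_le hab.le
    (fun x hx => (hG x hx).continuousWithinAt)
    (fun x hx => ((hG x (Ioo_subset_Icc_self hx)).hasDerivAt
      (Icc_mem_nhds hx.1 hx.2)).hasDerivWithinAt)
    hzc.integrableOn_Icc (fun x hx => by
      have hx' := Ioo_subset_Icc_self hx
      have hsq : (e - x) ^ 2 ≤ (b - a) ^ 2 := by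
        apply sq_le_sq' <;> linarith [he.1, he.2, hx'.1, hx'.2]
      have hw : m * (e - x) ^ 2 ≤ 1 / 2 := hmL ▸ mul_le_mul_of_nonneg_left hsq hm0.le
      have h1 : m * (m * (e - x) ^ 2) * z x ^ 2 ≤ m * (1 / 2) * z x ^ 2 := by gcongr
      have h2 : m / 2 * z x ^ 2 ≤
          z' x ^ 2 - m * (-z x ^ 2 + (e - x) * (2 * z x * z' x)) := by
        nlinarith [sq_nonneg (z' x - m * (e - x) * z x)]
      linarith [mul_le_mul_of_nonneg_left h2 hη.le, hle x hx'])
  rw [integral_const_mul, hea, heb] at key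
  rw [hc]
  linarith

theorem stmt_19 (a b : ℝ) (hab : a < b)
    (q₁ q₂ g : ℝ → ℝ) (q₁' q₂' g' : ℝ → ℝ)
    -- q₁, q₂, g continuous on [a,b] and continuously differentiable on (a,b)
    (hq₁cont : ContinuousOn q₁ (Icc a b))
    (hq₂cont : ContinuousOn q₂ (Icc a b))
    (hgcont : ContinuousOn g (Icc a b))
    (hq₁diff : ∀ x ∈ Ioo a b, HasDerivAt q₁ (q₁' x) x)
    (hq₁'cont : ContinuousOn q₁' (Ioo a b))
    (hq₂diff : ∀ x ∈ Ioo a b, HasDerivAt q₂ (q₂' x) x)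
    (hq₂'cont : ContinuousOn q₂' (Ioo a b))
    (hgdiff : ∀ x ∈ Ioo a b, HasDerivAt g (g' x) x)
    (hg'cont : ContinuousOn g' (Ioo a b))
    -- q₁ > q₂ > 0 on [a,b]
    (hq₂pos : ∀ x ∈ Icc a b, 0 < q₂ x)
    (hq₁q₂ : ∀ x ∈ Icc a b, q₂ x < q₁ x)
    -- z, y continuously differentiable on [a,b]
    (z y z' y' : ℝ → ℝ)
    (hz : ∀ x ∈ Icc a b, HasDerivWithinAt z (z' x) (Icc a b) x)
    (hz'cont : ContinuousOn z' (Icc a b))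
    (hy : ∀ x ∈ Icc a b, HasDerivWithinAt y (y' x) (Icc a b) x)
    (hy'cont : ContinuousOn y' (Icc a b))
    -- (q₁·z')' = g·z and (q₂·y')' = g·y on [a,b]
    (hzeq : ∀ x ∈ Icc a b,
      HasDerivWithinAt (fun t => q₁ t * z' t) (g x * z x) (Icc a b) x)
    (hyeq : ∀ x ∈ Icc a b,
      HasDerivWithinAt (fun t => q₂ t * y' t) (g x * y x) (Icc a b) x)
    -- y > 0 on [a,b]
    (hypos : ∀ x ∈ Icc a b, 0 < y x) :
    -- (i) the Sturm–Picone identity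
    (∀ x ∈ Ioo a b,
      HasDerivAt
        (fun t => z t / y t * (q₁ t * y t * z' t - q₂ t * y' t * z t))
        ((q₁ x - q₂ x) * (z' x) ^ 2
          + q₂ x * (z' x - y' x * z x / y x) ^ 2) x) ∧
    -- (ii) the comparison inequality
    ((∃ η : ℝ, 0 < η ∧ ∀ x ∈ Icc a b, η < q₁ x - q₂ x) →
      (z a = 0 ∨ z b = 0) →
      ∃ A : ℝ, 0 < A ∧
        A * (∫ x in a..b, (z x) ^ 2) ≤
          z b / y b * (q₁ b * y b * z' b - q₂ b * y' b * z b)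
            - z a / y a * (q₁ a * y a * z' a - q₂ a * y' a * z a)) := by
  have hF : ∀ x ∈ Icc a b, HasDerivWithinAt _ _ (Icc a b) x := fun x hx =>
    picone_hasDerivWithinAt (hz x hx) (hy x hx) (hzeq x hx) (hyeq x hx) (hypos x hx).ne'
  refine ⟨fun x hx => (hF x (Ioo_subset_Icc_self hx)).hasDerivAt (Icc_mem_nhds hx.1 hx.2), ?_⟩
  rintro ⟨η, hη, hηq⟩ h0
  have hL : 0 < b - a := sub_pos.2 hab
  refine ⟨η / (4 * (b - a) ^ 2), by positivity,
    const_mul_integral_sq_le_sub hab hη hF hz (fun x hx => ?_) h0⟩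
  have h1 : η * z' x ^ 2 ≤ (q₁ x - q₂ x) * z' x ^ 2 := by
    gcongr
    exact (hηq x hx).le
  have h2 : 0 ≤ q₂ x * (z' x - y' x * z x / y x) ^ 2 :=
    mul_nonneg (hq₂pos x hx).le (sq_nonneg _)
  linarith
end
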